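/- Let a ≥ 2 be an integer. For every ε > 0 there exists N such that for all integers n ≥ N one has |γ − p_{n,1}/q_n| ≤ exp((a·(cos(2π/a) − 1) + ε)·n^{1−1/a}). -/

import Mathlib

/-- `q_n = ∑_{k=0}^n C(n,k)^a · k!`. -/
noncomputable def qseq (a n : ℕ) : ℚ :=
  ∑ k ∈ Finset.range (n + 1), (n.choose k : ℚ) ^ a * (Nat.factorial k : ℚ)

/-- `p_{n,1} = ∑_{k=0}^n C(n,k)^a · k! · (a·H_{n-k} - (a-1)·H_k)`. -/
noncomputable def pseq1 (a n : ℕ) : ℚ :=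
  ∑ k ∈ Finset.range (n + 1), (n.choose k : ℚ) ^ a * (Nat.factorial k : ℚ) *
    ((a : ℚ) * harmonic (n - k) - ((a : ℚ) - 1) * harmonic k)

open Complex in
/-- The real part of `z log z - z - iβz` at `z = x + iy`. -/
noncomputable def phase (β x y : ℝ) : ℝ :=
  x * Real.log ‖(⟨x, y⟩ : ℂ)‖ - x + y * (β - Complex.arg ⟨x, y⟩)

theorem tangent_le_of_monotoneOn_deriv {f f' : ℝ → ℝ} {S : Set ℝ} (hS : S.OrdConnected)
    (hf : ∀ x ∈ S, HasDerivAt f (f' x) x) (hm : MonotoneOn f' S) {x y : ℝ}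
    (hx : x ∈ S) (hy : y ∈ S) : f x + f' x * (y - x) ≤ f y := by
  rcases lt_trichotomy x y with h | rfl | h
  · obtain ⟨c, hc, hc'⟩ := exists_hasDerivAt_eq_slope f f' h
      (fun z hz => (hf z (hS.out hx hy hz)).continuousAt.continuousWithinAt)
      (fun z hz => hf z (hS.out hx hy (Set.Ioo_subset_Icc_self hz)))
    have := hm hx (hS.out hx hy (Set.Ioo_subset_Icc_self hc)) hc.1.le
    rw [hc', le_div_iff₀ (by linarith)] at this
    linarith
  · simp
  · obtain ⟨c, hc, hc'⟩ := exists_hasDerivAt_eq_slope f f' h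
      (fun z hz => (hf z (hS.out hy hx hz)).continuousAt.continuousWithinAt)
      (fun z hz => hf z (hS.out hy hx (Set.Ioo_subset_Icc_self hz)))
    have := hm (hS.out hy hx (Set.Ioo_subset_Icc_self hc)) hx hc.2.le
    rw [hc', div_le_iff₀ (by linarith)] at this
    linarith

theorem cos_tangent_le {β θ : ℝ} (hβ : β ∈ Set.Icc (Real.pi / 2) Real.pi)
    (hθ : θ ∈ Set.Icc (Real.pi / 2) Real.pi) :
    Real.cos β - Real.sin β * (θ - β) ≤ Real.cos θ := by
  have := tangent_le_of_monotoneOn_deriv (f := Real.cos) (f' := fun x => -Real.sin x)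
    (S := Set.Icc (Real.pi / 2) Real.pi) Set.ordConnected_Icc (fun x _ => Real.hasDerivAt_cos x)
    (fun x hx y hy hxy => by
      have h := Real.sin_le_sin_of_le_of_le_pi_div_two (x := Real.pi - y) (y := Real.pi - x)
        (by linarith [hy.2, Real.pi_pos]) (by linarith [hx.1]) (by linarith)
      simpa using h) hβ hθ
  linarith

theorem log_cos_tangent_le {β θ : ℝ} (hβ : β ∈ Set.Ioo (-(Real.pi / 2)) (Real.pi / 2))
    (hθ : θ ∈ Set.Ioo (-(Real.pi / 2)) (Real.pi / 2)) :
    Real.log (Real.cos β) - Real.log (Real.cos θ) + Real.tan θ * (β - θ) ≤ 0 := by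
  have := tangent_le_of_monotoneOn_deriv (f := fun x => -Real.log (Real.cos x))
    (f' := Real.tan)
    (S := Set.Ioo (-(Real.pi / 2)) (Real.pi / 2)) Set.ordConnected_Ioo (fun x hx => by
      have h := ((Real.hasDerivAt_cos x).log (Real.cos_pos_of_mem_Ioo hx).ne').neg
      exact h.congr_deriv (by rw [Real.tan_eq_sin_div_cos]; ring)) Real.strictMonoOn_tan.monotoneOn hθ hβ
  linarith

theorem phase_le_of_nonpos {β x : ℝ} (hβ : β ∈ Set.Ico (Real.pi / 2) Real.pi) (hx : x ≤ 0) :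
    phase β x (Real.sin β) ≤ -Real.cos β := by
  have hs : 0 < Real.sin β := Real.sin_pos_of_pos_of_lt_pi (by linarith [hβ.1, Real.pi_pos]) hβ.2
  unfold phase
  set z : ℂ := ⟨x, Real.sin β⟩ with hz
  have hz0 : z ≠ 0 := fun h => hs.ne' (by simpa [hz] using congrArg Complex.im h)
  have hr : 0 < ‖z‖ := norm_pos_iff.mpr hz0
  have h1 := Real.one_sub_inv_le_log_of_pos hr
  have hc : x * ‖z‖⁻¹ = Real.cos z.arg := by
    rw [Complex.cos_arg hz0]; rfl
  have hθ0 : 0 ≤ z.arg := Complex.arg_nonneg_iff.mpr hs.le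
  have hθ : Real.pi / 2 ≤ z.arg := by
    by_contra h
    push Not at h
    have := Real.cos_pos_of_mem_Ioo ⟨by linarith [Real.pi_pos], h⟩
    rw [← hc] at this
    have := mul_nonpos_of_nonpos_of_nonneg hx (inv_pos.mpr hr).le
    linarith
  have ht := cos_tangent_le ⟨hβ.1, hβ.2.le⟩ ⟨hθ, Complex.arg_le_pi z⟩
  have h2 := mul_le_mul_of_nonpos_left h1 hx
  nlinarith

theorem phase_le_of_pos {β x y : ℝ} (hβ : β ∈ Set.Ico (Real.pi / 2) Real.pi) (hx : 0 < x)
    (hx1 : x ≤ 1) (hy : 0 ≤ y) (hyβ : y ≤ Real.sin β) :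
    phase β x y ≤ -Real.cos β + x := by
  unfold phase
  set z : ℂ := ⟨x, y⟩ with hz
  have hz0 : z ≠ 0 := fun h => hx.ne' (by simpa [hz] using congrArg Complex.re h)
  have hr : 0 < ‖z‖ := norm_pos_iff.mpr hz0
  have hy1 : y ≤ 1 := hyβ.trans (Real.sin_le_one β)
  have hr2 : ‖z‖ ≤ 2 := by
    refine (Complex.norm_le_abs_re_add_abs_im z).trans ?_
    simp only [hz, abs_of_pos hx, abs_of_nonneg hy]; linarith
  have hlog : Real.log ‖z‖ ≤ 1 := by
    rw [Real.log_le_iff_le_exp hr]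
    linarith [Real.add_one_le_exp (1 : ℝ)]
  have h1 : x * Real.log ‖z‖ - x ≤ 0 := by nlinarith
  have hθ0 : 0 ≤ z.arg := Complex.arg_nonneg_iff.mpr hy
  have hθ : z.arg < Real.pi / 2 :=
    (abs_lt.mp (Complex.abs_arg_lt_pi_div_two_iff.mpr (Or.inl hx))).2
  -- The angle estimate `y (π/2 - θ) ≤ x`
  have h2 : y * (Real.pi / 2 - z.arg) ≤ x := by
    have hlt := Real.le_tan (x := Real.pi / 2 - z.arg) (by linarith) 
    rcases hy.eq_or_lt with rfl | hy'
    · simp [hx.le]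
    · have hθp : 0 < z.arg := by
        refine lt_of_le_of_ne hθ0 fun h => ?_
        have := (Complex.arg_eq_zero_iff.mp h.symm).2
        simp [hz] at this; linarith
      have := hlt (by linarith)
      rw [Real.tan_pi_div_two_sub, Complex.tan_arg] at this
      simp only [hz] at this
      rw [inv_div, le_div_iff₀ hy'] at this
      linarith
  have hs0 : 0 ≤ β - Real.pi / 2 := by linarith [hβ.1]
  have h3 := cos_tangent_le ⟨hβ.1, hβ.2.le⟩ (θ := Real.pi / 2) ⟨le_rfl, by linarith [Real.pi_pos]⟩
  rw [Real.cos_pi_div_two] at h3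
  have h4 := mul_le_mul_of_nonneg_right hyβ hs0
  nlinarith

theorem phase_le_of_eq_cos {β y : ℝ} (hβ : β ∈ Set.Ico 0 (Real.pi / 2)) :
    phase β (Real.cos β) y ≤ -Real.cos β := by
  have hc : 0 < Real.cos β := Real.cos_pos_of_mem_Ioo ⟨by linarith [hβ.1, Real.pi_pos], hβ.2⟩
  unfold phase
  set z : ℂ := ⟨Real.cos β, y⟩ with hz
  have hz0 : z ≠ 0 := fun h => hc.ne' (by simpa [hz] using congrArg Complex.re h)
  have hr : 0 < ‖z‖ := norm_pos_iff.mpr hz0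
  have hθ := abs_lt.mp (Complex.abs_arg_lt_pi_div_two_iff.mpr (Or.inl hc : 0 < z.re ∨ z = 0))
  have hcθ := Real.cos_pos_of_mem_Ioo ⟨hθ.1, hθ.2⟩
  have h := log_cos_tangent_le ⟨by linarith [hβ.1, Real.pi_pos], hβ.2⟩ ⟨hθ.1, hθ.2⟩ (β := β)
  have h1 : Real.log ‖z‖ = Real.log (Real.cos β) - Real.log (Real.cos z.arg) := by
    rw [← Real.log_div hc.ne' hcθ.ne', Complex.cos_arg hz0]
    congr 1
    simp only [hz]; field_simp
  have h2 : Real.cos β * Real.tan z.arg = y := by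
    rw [Complex.tan_arg]; simp only [hz]; field_simp
  rw [← h1] at h
  have := mul_nonpos_of_nonneg_of_nonpos hc.le h
  rw [mul_add, ← mul_assoc, h2] at this
  linarith

theorem hasDerivAt_phase (β : ℝ) {x y : ℝ} (hs : (⟨x, y⟩ : ℂ) ∈ Complex.slitPlane) :
    HasDerivAt (fun x => phase β x y) (Real.log ‖(⟨x, y⟩ : ℂ)‖) x := by
  have hz : ∀ x : ℝ, (⟨x, y⟩ : ℂ) = x + y * Complex.I := fun x => by apply Complex.ext <;> simp
  have heq : ∀ x : ℝ, phase β x y = ((x + y * Complex.I) * Complex.log (x + y * Complex.I)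
      - (x + y * Complex.I)).re + y * β := by
    intro x
    simp [phase, hz, Complex.log_re, Complex.log_im]
    ring
  rw [hz] at hs ⊢
  have h1 : HasDerivAt (fun z : ℂ => (z + y * Complex.I) * Complex.log (z + y * Complex.I)
      - (z + y * Complex.I)) (Complex.log (x + y * Complex.I)) x := by
    have ha : HasDerivAt (fun z : ℂ => z + y * Complex.I) 1 (x : ℂ) :=
      (hasDerivAt_id _).add_const _
    refine ((ha.mul (ha.clog hs)).sub ha).congr_deriv ?_
    rw [mul_one_div_cancel (Complex.slitPlane_ne_zero hs)]; ring
  have h2 := (h1.real_of_complex).add_const (y * β)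
  rw [Complex.log_re] at h2
  exact h2.congr_of_eventuallyEq (Filter.Eventually.of_forall heq)

theorem phase_one_monotone (β : ℝ) : Monotone fun x => phase β x 1 := by
  have hd : ∀ x : ℝ, HasDerivAt (fun x => phase β x 1) (Real.log ‖(⟨x, 1⟩ : ℂ)‖) x := fun x =>
    hasDerivAt_phase β (Complex.mem_slitPlane_iff.mpr (Or.inr one_ne_zero))
  refine monotone_of_deriv_nonneg (fun x => (hd x).differentiableAt) fun x => ?_
  rw [(hd x).deriv]
  refine Real.log_nonneg ?_
  have := Complex.abs_im_le_norm (⟨x, 1⟩ : ℂ)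
  simpa using this

theorem exists_phase_contour {a : ℕ} (ha : 2 ≤ a) {δ : ℝ} (hδ : 0 < δ) :
    ∃ κ η : ℝ, 0 < κ ∧ κ ≤ 1 ∧ 0 < η ∧ η ≤ 1 ∧
      (∀ y, 0 ≤ y → y ≤ η →
        phase (Real.pi - 2 * Real.pi / a) κ y ≤ Real.cos (2 * Real.pi / a) + δ) ∧
      (∀ x, x ≤ κ →
        phase (Real.pi - 2 * Real.pi / a) x η ≤ Real.cos (2 * Real.pi / a) + δ) := by
  set β := Real.pi - 2 * Real.pi / a with hβ
  have hcos : Real.cos (2 * Real.pi / a) = -Real.cos β := by rw [hβ, Real.cos_pi_sub]; ring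
  rw [hcos]
  have ha' : (2 : ℝ) ≤ a := by exact_mod_cast ha
  have hpi := Real.pi_pos
  have hβpi : β < Real.pi := by
    have : 0 < 2 * Real.pi / a := by positivity
    linarith
  rcases lt_or_ge β (Real.pi / 2) with h | h
  · have hβ0 : 0 ≤ β := by
      have : 2 * Real.pi / a ≤ Real.pi := by
        rw [div_le_iff₀ (by linarith)]; nlinarith
      linarith
    refine ⟨Real.cos β, 1, Real.cos_pos_of_mem_Ioo ⟨by linarith, h⟩, Real.cos_le_one _,
      one_pos, le_rfl, fun y _ _ => ?_, fun x hx => ?_⟩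
    · linarith [phase_le_of_eq_cos (y := y) ⟨hβ0, h⟩]
    · have := phase_one_monotone β hx
      have h2 := phase_le_of_eq_cos (y := 1) ⟨hβ0, h⟩
      simp only at this
      linarith
  · refine ⟨min δ 1, Real.sin β, by positivity, min_le_right _ _,
      Real.sin_pos_of_pos_of_lt_pi (by linarith) hβpi, Real.sin_le_one _,
      fun y hy hyβ => ?_, fun x hx => ?_⟩
    · have := phase_le_of_pos ⟨h, hβpi⟩ (by positivity : 0 < min δ 1) (min_le_right _ _) hy hyβ
      linarith [min_le_left δ 1]
    · rcases le_or_gt x 0 with hx0 | hx0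
      · linarith [phase_le_of_nonpos ⟨h, hβpi⟩ hx0]
      · have := phase_le_of_pos ⟨h, hβpi⟩ hx0 (hx.trans (min_le_right _ _))
          (Real.sin_pos_of_pos_of_lt_pi (by linarith) hβpi).le le_rfl
        linarith [min_le_left δ 1]

open Complex in
/-- The counterclockwise integral over the boundary of `[x₀, x₁] × [-h, h]`. -/
noncomputable def rectIntegral (f : ℂ → ℂ) (x₀ x₁ h : ℝ) : ℂ :=
  (∫ x : ℝ in x₀..x₁, f (x + (-h : ℝ) * I)) - (∫ x : ℝ in x₀..x₁, f (x + h * I)) +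
    I • (∫ y : ℝ in (-h)..h, f (x₁ + y * I)) - I • (∫ y : ℝ in (-h)..h, f (x₀ + y * I))

/-- The boundary of the rectangle `[x₀, x₁] × [-h, h]`. -/
def rectBoundary (x₀ x₁ h : ℝ) : Set ℂ :=
  {s | s.re ∈ Set.uIcc x₀ x₁ ∧ s.im ∈ Set.uIcc (-h) h ∧
    (s.im = -h ∨ s.im = h ∨ s.re = x₁ ∨ s.re = x₀)}

section
open Complex

variable {f g : ℂ → ℂ} {x₀ x₁ h : ℝ}

theorem bottom_mem_rectBoundary {x : ℝ} (hx : x ∈ Set.uIcc x₀ x₁) :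
    (x + (-h : ℝ) * I : ℂ) ∈ rectBoundary x₀ x₁ h := by
  refine ⟨by simpa using hx, ?_, by simp⟩
  simp

theorem top_mem_rectBoundary {x : ℝ} (hx : x ∈ Set.uIcc x₀ x₁) :
    (x + h * I : ℂ) ∈ rectBoundary x₀ x₁ h := by
  refine ⟨by simpa using hx, ?_, by simp⟩
  simp

theorem right_mem_rectBoundary {y : ℝ} (hy : y ∈ Set.uIcc (-h) h) :
    (x₁ + y * I : ℂ) ∈ rectBoundary x₀ x₁ h := by
  refine ⟨by simp, by simpa using hy, by simp⟩

theorem left_mem_rectBoundary {y : ℝ} (hy : y ∈ Set.uIcc (-h) h) :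
    (x₀ + y * I : ℂ) ∈ rectBoundary x₀ x₁ h := by
  refine ⟨by simp, by simpa using hy, by simp⟩

theorem intervalIntegrable_bottom (hf : ContinuousOn f (rectBoundary x₀ x₁ h)) :
    IntervalIntegrable (fun x : ℝ => f (x + (-h : ℝ) * I)) MeasureTheory.volume x₀ x₁ :=
  (hf.comp (by fun_prop) fun _ hx => bottom_mem_rectBoundary hx).intervalIntegrable

theorem intervalIntegrable_top (hf : ContinuousOn f (rectBoundary x₀ x₁ h)) :
    IntervalIntegrable (fun x : ℝ => f (x + h * I)) MeasureTheory.volume x₀ x₁ :=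
  (hf.comp (by fun_prop) fun _ hx => top_mem_rectBoundary hx).intervalIntegrable

theorem intervalIntegrable_right (hf : ContinuousOn f (rectBoundary x₀ x₁ h)) :
    IntervalIntegrable (fun y : ℝ => f (x₁ + y * I)) MeasureTheory.volume (-h) h :=
  (hf.comp (by fun_prop) fun _ hx => right_mem_rectBoundary hx).intervalIntegrable

theorem intervalIntegrable_left (hf : ContinuousOn f (rectBoundary x₀ x₁ h)) :
    IntervalIntegrable (fun y : ℝ => f (x₀ + y * I)) MeasureTheory.volume (-h) h :=
  (hf.comp (by fun_prop) fun _ hx => left_mem_rectBoundary hx).intervalIntegrable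

theorem rectIntegral_congr (hfg : Set.EqOn f g (rectBoundary x₀ x₁ h)) :
    rectIntegral f x₀ x₁ h = rectIntegral g x₀ x₁ h := by
  unfold rectIntegral
  rw [intervalIntegral.integral_congr fun x hx => hfg (bottom_mem_rectBoundary hx),
    intervalIntegral.integral_congr fun x hx => hfg (top_mem_rectBoundary hx),
    intervalIntegral.integral_congr fun x hx => hfg (right_mem_rectBoundary hx),
    intervalIntegral.integral_congr fun x hx => hfg (left_mem_rectBoundary hx)]

theorem rectIntegral_add (hf : ContinuousOn f (rectBoundary x₀ x₁ h))
    (hg : ContinuousOn g (rectBoundary x₀ x₁ h)) :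
    rectIntegral (fun s => f s + g s) x₀ x₁ h =
      rectIntegral f x₀ x₁ h + rectIntegral g x₀ x₁ h := by
  unfold rectIntegral
  rw [intervalIntegral.integral_add (intervalIntegrable_bottom hf) (intervalIntegrable_bottom hg),
    intervalIntegral.integral_add (intervalIntegrable_top hf) (intervalIntegrable_top hg),
    intervalIntegral.integral_add (intervalIntegrable_right hf) (intervalIntegrable_right hg),
    intervalIntegral.integral_add (intervalIntegrable_left hf) (intervalIntegrable_left hg)]
  simp only [smul_eq_mul]
  ring

theorem rectIntegral_const_mul (c : ℂ) :
    rectIntegral (fun s => c * f s) x₀ x₁ h = c * rectIntegral f x₀ x₁ h := by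
  unfold rectIntegral
  simp only [intervalIntegral.integral_const_mul, smul_eq_mul]
  ring

theorem rectIntegral_eq_zero_of_differentiableOn
    (hf : DifferentiableOn ℂ f (Set.uIcc x₀ x₁ ×ℂ Set.uIcc (-h) h)) :
    rectIntegral f x₀ x₁ h = 0 :=
  integral_boundary_rect_eq_zero_of_differentiableOn f ⟨x₀, -h⟩ ⟨x₁, h⟩ hf

theorem integral_horizontal_of_hasDerivAt {c : ℝ}
    (hg : ∀ x ∈ Set.uIcc x₀ x₁, HasDerivAt g (f (x + c * I)) (x + c * I))
    (hf : IntervalIntegrable (fun x : ℝ => f (x + c * I)) MeasureTheory.volume x₀ x₁) :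
    ∫ x : ℝ in x₀..x₁, f (x + c * I) = g (x₁ + c * I) - g (x₀ + c * I) := by
  refine intervalIntegral.integral_eq_sub_of_hasDerivAt (f := fun x : ℝ => g (x + c * I))
    (fun x hx => ?_) hf
  exact ((hg x hx).comp_add_const (x : ℂ) (c * I)).comp_ofReal

theorem integral_vertical_of_hasDerivAt {c : ℝ}
    (hg : ∀ y ∈ Set.uIcc (-h) h, HasDerivAt g (f (c + y * I)) (c + y * I))
    (hf : IntervalIntegrable (fun y : ℝ => f (c + y * I)) MeasureTheory.volume (-h) h) :
    I • ∫ y : ℝ in (-h)..h, f (c + y * I) = g (c + h * I) - g (c + (-h : ℝ) * I) := by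
  rw [← intervalIntegral.integral_smul]
  refine intervalIntegral.integral_eq_sub_of_hasDerivAt (f := fun y : ℝ => g (c + y * I))
    (fun y hy => ?_) (hf.smul I)
  have h1 : HasDerivAt (fun y : ℂ => (c + y * I : ℂ)) I (y : ℂ) := by
    simpa using ((hasDerivAt_id (y : ℂ)).mul_const I).const_add (c : ℂ)
  have := (HasDerivAt.comp (y : ℂ) (hg y hy) h1).comp_ofReal
  simpa [mul_comm, Function.comp_def] using this

theorem rectIntegral_eq_zero_of_hasDerivAt (hf : ContinuousOn f (rectBoundary x₀ x₁ h))
    (hg : ∀ s ∈ rectBoundary x₀ x₁ h, HasDerivAt g (f s) s) :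
    rectIntegral f x₀ x₁ h = 0 := by
  unfold rectIntegral
  rw [integral_horizontal_of_hasDerivAt (fun x hx => hg _ (bottom_mem_rectBoundary hx))
      (intervalIntegrable_bottom hf),
    integral_horizontal_of_hasDerivAt (fun x hx => hg _ (top_mem_rectBoundary hx))
      (intervalIntegrable_top hf),
    integral_vertical_of_hasDerivAt (fun x hx => hg _ (right_mem_rectBoundary hx))
      (intervalIntegrable_right hf),
    integral_vertical_of_hasDerivAt (fun x hx => hg _ (left_mem_rectBoundary hx))
      (intervalIntegrable_left hf)]
  ring

theorem log_neg_of_im_pos {z : ℂ} (hz : 0 < z.im) : log (-z) = log z - Real.pi * I := by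
  apply Complex.ext <;> simp [log_re, log_im, arg_neg_eq_arg_sub_pi_of_im_pos hz]

theorem sub_ne_zero_of_mem_rectBoundary {p : ℝ} (h0 : x₀ < p) (h1 : p < x₁) (hh : 0 < h)
    {s : ℂ} (hs : s ∈ rectBoundary x₀ x₁ h) : s - p ≠ 0 := by
  intro h'
  have hre := congrArg re h'
  have him := congrArg im h'
  simp at hre him
  rcases hs.2.2 with h2 | h2 | h2 | h2 <;> linarith

theorem rectIntegral_inv_sub {p : ℝ} (h0 : x₀ < p) (h1 : p < x₁) (hh : 0 < h) :
    rectIntegral (fun s => (s - p)⁻¹) x₀ x₁ h = 2 * Real.pi * I := by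
  have hne := fun s (hs : s ∈ rectBoundary x₀ x₁ h) =>
    sub_ne_zero_of_mem_rectBoundary h0 h1 hh hs
  have hf : ContinuousOn (fun s : ℂ => (s - p)⁻¹) (rectBoundary x₀ x₁ h) :=
    ContinuousOn.inv₀ (by fun_prop) hne
  have hlog : ∀ s : ℂ, s - p ∈ slitPlane → HasDerivAt (fun s : ℂ => log (s - p)) (s - p)⁻¹ s := by
    intro s hs
    simpa using ((hasDerivAt_id s).sub_const (p : ℂ)).clog hs
  have hlog' : ∀ s : ℂ, p - s ∈ slitPlane → HasDerivAt (fun s : ℂ => log (p - s)) (s - p)⁻¹ s := by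
    intro s hs
    refine (((hasDerivAt_id s).const_sub (p : ℂ)).clog hs).congr_deriv ?_
    simp only [id]
    rw [← neg_sub s (p : ℂ), neg_div_neg_eq, one_div]
  unfold rectIntegral
  rw [integral_horizontal_of_hasDerivAt (g := fun s => log (s - p))
      (fun x hx => hlog _ (by rw [mem_slitPlane_iff]; right; simpa using hh.ne'))
      (intervalIntegrable_bottom hf),
    integral_horizontal_of_hasDerivAt (g := fun s => log (s - p))
      (fun x hx => hlog _ (by rw [mem_slitPlane_iff]; right; simpa using hh.ne'))
      (intervalIntegrable_top hf),
    integral_vertical_of_hasDerivAt (g := fun s => log (s - p))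
      (fun x hx => hlog _ (by rw [mem_slitPlane_iff]; left; simpa using h1))
      (intervalIntegrable_right hf),
    integral_vertical_of_hasDerivAt (g := fun s => log (p - s))
      (fun x hx => hlog' _ (by rw [mem_slitPlane_iff]; left; simpa using h0))
      (intervalIntegrable_left hf)]
  have e1 := log_neg_of_im_pos (z := x₀ + h * I - p) (by simpa using hh)
  have e2 := log_neg_of_im_pos (z := p - (x₀ + (-h : ℝ) * I)) (by simpa using hh)
  rw [neg_sub] at e1 e2
  rw [e1, e2]
  ring

theorem rectIntegral_inv_sub_sq {p : ℝ} (h0 : x₀ < p) (h1 : p < x₁) (hh : 0 < h) :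
    rectIntegral (fun s => ((s - p) ^ 2)⁻¹) x₀ x₁ h = 0 := by
  have hne := fun s (hs : s ∈ rectBoundary x₀ x₁ h) =>
    sub_ne_zero_of_mem_rectBoundary h0 h1 hh hs
  refine rectIntegral_eq_zero_of_hasDerivAt (g := fun s => -(s - p)⁻¹)
    (ContinuousOn.inv₀ (by fun_prop) fun s hs => pow_ne_zero 2 (hne s hs)) fun s hs => ?_
  have := (((hasDerivAt_id s).sub_const (p : ℂ)).fun_inv (hne s hs)).neg
  exact this.congr_deriv (by simp [neg_div])

theorem rectBoundary_subset : rectBoundary x₀ x₁ h ⊆ Set.uIcc x₀ x₁ ×ℂ Set.uIcc (-h) h :=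
  fun _ hs => ⟨hs.1, hs.2.1⟩

/-- The residue at a double pole. -/
theorem rectIntegral_of_double_pole {D : ℂ → ℂ} {U : Set ℂ} {p : ℝ} (hU : IsOpen U)
    (hR : Set.uIcc x₀ x₁ ×ℂ Set.uIcc (-h) h ⊆ U) (hD : DifferentiableOn ℂ D U)
    (h0 : x₀ < p) (h1 : p < x₁) (hh : 0 < h)
    (hf : ∀ s ∈ U, s ≠ p → f s = D s / (s - p) ^ 2) :
    rectIntegral f x₀ x₁ h = 2 * Real.pi * I * deriv D p := by
  have hne := fun s (hs : s ∈ rectBoundary x₀ x₁ h) =>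
    sub_ne_zero_of_mem_rectBoundary h0 h1 hh hs
  have hpU : (p : ℂ) ∈ U := hR ⟨by
      rw [Set.mem_preimage, ofReal_re]; exact Set.mem_uIcc_of_le h0.le h1.le, by
      rw [Set.mem_preimage, ofReal_im]; exact Set.mem_uIcc_of_le (by linarith) hh.le⟩
  have hpn : U ∈ nhds (p : ℂ) := hU.mem_nhds hpU
  set E := dslope D p
  have hE : DifferentiableOn ℂ E U := (differentiableOn_dslope hpn).mpr hD
  set E₂ := dslope E p
  have hE₂ : DifferentiableOn ℂ E₂ U := (differentiableOn_dslope hpn).mpr hE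
  have hEp : E p = deriv D p := dslope_same _ _
  have hc1 : ContinuousOn (fun s : ℂ => D p * ((s - p) ^ 2)⁻¹) (rectBoundary x₀ x₁ h) :=
    continuousOn_const.mul
      (ContinuousOn.inv₀ (by fun_prop) fun s hs => pow_ne_zero 2 (hne s hs))
  have hc2 : ContinuousOn (fun s : ℂ => deriv D p * (s - p)⁻¹) (rectBoundary x₀ x₁ h) :=
    continuousOn_const.mul (ContinuousOn.inv₀ (by fun_prop) hne)
  have hc3 : ContinuousOn E₂ (rectBoundary x₀ x₁ h) :=
    hE₂.continuousOn.mono (rectBoundary_subset.trans hR)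
  rw [rectIntegral_congr (g := fun s => (D p * ((s - p) ^ 2)⁻¹ + deriv D p * (s - p)⁻¹) + E₂ s),
    rectIntegral_add (hc1.fun_add hc2) hc3, rectIntegral_add hc1 hc2, rectIntegral_const_mul,
    rectIntegral_const_mul, rectIntegral_inv_sub h0 h1 hh, rectIntegral_inv_sub_sq h0 h1 hh,
    rectIntegral_eq_zero_of_differentiableOn (hE₂.mono hR)]
  · ring
  · intro s hs
    have hs' := hne s hs
    have e1 := sub_smul_dslope D (p : ℂ) s
    have e2 := sub_smul_dslope E (p : ℂ) s
    rw [hEp] at e2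
    simp only [smul_eq_mul] at e1 e2
    rw [hf s (hR (rectBoundary_subset hs)) (sub_ne_zero.mp hs')]
    have e3 : D s = D p + (s - p) * (deriv D p + (s - p) * E₂ s) := by
      rw [show E₂ s = dslope E p s from rfl, e2]
      change D s = D p + (s - p) * (deriv D p + (dslope D p s - deriv D p))
      linear_combination -e1
    rw [e3]
    field_simp
    ring

/-- Integrals over adjacent rectangles of the same height add up. -/
theorem sum_rectIntegral {x : ℕ → ℝ} {M : ℕ}
    (hb : ∀ k < M, IntervalIntegrable (fun t : ℝ => f (t + (-h : ℝ) * I))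
      MeasureTheory.volume (x (k + 1)) (x k))
    (ht : ∀ k < M, IntervalIntegrable (fun t : ℝ => f (t + h * I))
      MeasureTheory.volume (x (k + 1)) (x k)) :
    ∑ k ∈ Finset.range M, rectIntegral f (x (k + 1)) (x k) h = rectIntegral f (x M) (x 0) h := by
  induction M with
  | zero => simp [rectIntegral]
  | succ M ih =>
    rw [Finset.sum_range_succ, ih (fun k hk => hb k (by omega)) (fun k hk => ht k (by omega))]
    have key : ∀ g : ℝ → ℂ, (∀ k < M + 1, IntervalIntegrable g MeasureTheory.volume
        (x (k + 1)) (x k)) →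
        (∫ t in (x (M + 1))..(x 0), g t) =
          (∫ t in (x (M + 1))..(x M), g t) + ∫ t in (x M)..(x 0), g t := by
      intro g hg
      refine (intervalIntegral.integral_add_adjacent_intervals (hg M (by omega)) ?_).symm
      exact (IntervalIntegrable.trans_iterate fun k hk => (hg k (by omega)).symm).symm
    unfold rectIntegral
    rw [key _ hb, key _ ht]
    simp only [smul_eq_mul]
    ring

/-- The norm of a rectangle integral is at most the perimeter times the maximum. -/
theorem norm_rectIntegral_le {C : ℝ} (hx : x₀ ≤ x₁) (hh : 0 ≤ h)
    (hf : ∀ s ∈ rectBoundary x₀ x₁ h, ‖f s‖ ≤ C) :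
    ‖rectIntegral f x₀ x₁ h‖ ≤ C * (2 * (x₁ - x₀) + 4 * h) := by
  have b1 := intervalIntegral.norm_integral_le_of_norm_le_const (a := x₀) (b := x₁) (C := C)
    (f := fun x : ℝ => f (x + (-h : ℝ) * I)) fun x hx' =>
      hf _ (bottom_mem_rectBoundary (Set.uIoc_subset_uIcc hx'))
  have b2 := intervalIntegral.norm_integral_le_of_norm_le_const (a := x₀) (b := x₁) (C := C)
    (f := fun x : ℝ => f (x + h * I)) fun x hx' =>
      hf _ (top_mem_rectBoundary (Set.uIoc_subset_uIcc hx'))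
  have b3 := intervalIntegral.norm_integral_le_of_norm_le_const (a := -h) (b := h) (C := C)
    (f := fun y : ℝ => f (x₁ + y * I)) fun x hx' =>
      hf _ (right_mem_rectBoundary (Set.uIoc_subset_uIcc hx'))
  have b4 := intervalIntegral.norm_integral_le_of_norm_le_const (a := -h) (b := h) (C := C)
    (f := fun y : ℝ => f (x₀ + y * I)) fun x hx' =>
      hf _ (left_mem_rectBoundary (Set.uIoc_subset_uIcc hx'))
  rw [abs_of_nonneg (by linarith)] at b1 b2 b3 b4
  unfold rectIntegral
  refine (norm_sub_le _ _).trans ?_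
  refine (add_le_add_left ((norm_add_le _ _).trans
    (add_le_add_left (norm_sub_le _ _) _)) _).trans ?_
  simp only [norm_smul, norm_I, one_mul]
  linarith

end

section
open Complex

/-- The product `s (s + 1) ⋯ (s + n)`. -/
noncomputable def risingProd (n : ℕ) (s : ℂ) : ℂ := ∏ k ∈ Finset.range (n + 1), (s + k)

/-- The entire function `1 / (Γ(n + 1 + s) Γ(1 - s))`. -/
noncomputable def invGammaProd (n : ℕ) (s : ℂ) : ℂ := (Gamma (n + 1 + s))⁻¹ * (Gamma (1 - s))⁻¹

/-- The function interpolating `C(n, j)^(b + 2) (n - j)!` at the points `-j`. -/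
noncomputable def interpolant (b n : ℕ) (s : ℂ) : ℂ :=
  (n.factorial : ℂ) ^ (b + 2) * Gamma (n + 1 + s) * invGammaProd n s ^ (b + 2)

/-- The meromorphic function whose residue at `-j` is the derivative of `interpolant` there. -/
noncomputable def residueKernel (b n : ℕ) (s : ℂ) : ℂ :=
  (n.factorial : ℂ) ^ (b + 2) * Gamma (n + 1 + s) * invGammaProd n s ^ b / risingProd n s ^ 2

variable {b n : ℕ} {s : ℂ}

theorem risingProd_ne_zero_iff : risingProd n s ≠ 0 ↔ ∀ k ≤ n, s + k ≠ 0 := by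
  simp [risingProd, Finset.prod_ne_zero_iff]

theorem Gamma_add_eq_risingProd_mul (hs : risingProd n s ≠ 0) :
    Gamma (n + 1 + s) = risingProd n s * Gamma s := by
  induction n with
  | zero =>
    have h := risingProd_ne_zero_iff.mp hs 0 le_rfl
    simp only [Nat.cast_zero, add_zero] at h
    simp [risingProd, add_comm (1 : ℂ), Gamma_add_one s h]
  | succ n ih =>
    have h := risingProd_ne_zero_iff.mp hs
    have h' : risingProd n s ≠ 0 := risingProd_ne_zero_iff.mpr fun k hk => h k (by omega)
    have e : ((n + 1 : ℕ) : ℂ) + 1 + s = (s + (n + 1 : ℕ)) + 1 := by ring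
    rw [e, Gamma_add_one _ (h (n + 1) le_rfl)]
    rw [show s + ((n + 1 : ℕ) : ℂ) = n + 1 + s by push_cast; ring, ih h']
    unfold risingProd
    rw [Finset.prod_range_succ _ (n + 1)]
    push_cast
    ring

theorem invGammaProd_eq (hs : risingProd n s ≠ 0) :
    invGammaProd n s = sin (Real.pi * s) / (Real.pi * risingProd n s) := by
  unfold invGammaProd
  rw [Gamma_add_eq_risingProd_mul hs, ← mul_inv, mul_assoc, Gamma_mul_Gamma_one_sub, mul_inv,
    inv_div, div_eq_mul_inv, div_eq_mul_inv, mul_inv]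
  ring

theorem residueKernel_eq_interpolant_mul (hs : risingProd n s ≠ 0)
    (hsin : sin (Real.pi * s) ≠ 0) :
    residueKernel b n s = interpolant b n s * (Real.pi / sin (Real.pi * s)) ^ 2 := by
  have hpi : (Real.pi : ℂ) ≠ 0 := by exact_mod_cast Real.pi_ne_zero
  unfold residueKernel interpolant
  rw [pow_add, invGammaProd_eq hs]
  simp only [div_pow, mul_pow, pow_add]
  generalize sin (Real.pi * s) = w at *
  field_simp

theorem residueKernel_eq (hs : risingProd n s ≠ 0) :
    residueKernel b n s = Gamma (n + 1 + s) * (n.factorial / risingProd n s) ^ (b + 2) *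
      (sin (Real.pi * s) / Real.pi) ^ b := by
  have hpi : (Real.pi : ℂ) ≠ 0 := by exact_mod_cast Real.pi_ne_zero
  unfold residueKernel
  rw [invGammaProd_eq hs]
  simp only [div_pow, mul_pow, pow_add]
  field_simp

theorem differentiable_risingProd : Differentiable ℂ (risingProd n) := by
  unfold risingProd
  fun_prop

theorem differentiable_invGammaProd : Differentiable ℂ (invGammaProd n) := by
  have h := differentiable_one_div_Gamma
  exact (h.comp ((differentiable_const ((n : ℂ) + 1)).add differentiable_id)).mul
    (h.comp ((differentiable_const (1 : ℂ)).sub differentiable_id))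

theorem differentiableAt_Gamma_add (hs : -(n + 1 : ℝ) < s.re) :
    DifferentiableAt ℂ (fun s => Gamma (n + 1 + s)) s := by
  have : DifferentiableAt ℂ Gamma (n + 1 + s) := by
    refine differentiableAt_Gamma _ fun m hm => ?_
    have := congrArg re hm
    simp at this
    have : (0 : ℝ) ≤ m := Nat.cast_nonneg m
    linarith
  exact this.comp s (by fun_prop)

theorem differentiableAt_interpolant (hs : -(n + 1 : ℝ) < s.re) :
    DifferentiableAt ℂ (interpolant b n) s :=
  ((differentiableAt_Gamma_add hs).const_mul _).mul
    ((differentiable_invGammaProd s).pow _)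

theorem differentiableAt_residueKernel (hs : -(n + 1 : ℝ) < s.re) (hP : risingProd n s ≠ 0) :
    DifferentiableAt ℂ (residueKernel b n) s :=
  (((differentiableAt_Gamma_add hs).const_mul _).mul
    ((differentiable_invGammaProd s).pow _)).div
    ((differentiable_risingProd s).pow 2) (pow_ne_zero 2 hP)

theorem hasDerivAt_interpolant {j : ℕ} (hj : j ≤ n) :
    HasDerivAt (interpolant b n) ((n.choose j : ℂ) ^ (b + 2) * ((n - j).factorial : ℂ) *
      ((b + 2 : ℂ) * harmonic j - (b + 1 : ℂ) * harmonic (n - j)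
        - Real.eulerMascheroniConstant)) (-j) := by
  have hG1 : HasDerivAt (fun s : ℂ => Gamma (n + 1 + s))
      ((n - j).factorial * (-Real.eulerMascheroniConstant + harmonic (n - j))) (-j) := by
    have h := hasDerivAt_Gamma_nat (n - j)
    have e : ((n - j : ℕ) : ℂ) + 1 = n + 1 + (-j) := by push_cast [Nat.cast_sub hj]; ring
    rw [e] at h
    exact h.comp_const_add _ _
  have hG2 : HasDerivAt (fun s : ℂ => Gamma (1 - s))
      (-(j.factorial * (-Real.eulerMascheroniConstant + harmonic j))) (-j) := by
    have h := hasDerivAt_Gamma_nat j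
    have e : (j : ℂ) + 1 = 1 - (-j) := by ring
    rw [e] at h
    exact h.comp_const_sub _ _
  have v1 : Gamma ((n : ℂ) + 1 + (-j)) = (n - j).factorial := by
    rw [← Gamma_nat_eq_factorial]; congr 1; push_cast [Nat.cast_sub hj]; ring
  have v2 : Gamma (1 - (-j : ℂ)) = j.factorial := by
    rw [← Gamma_nat_eq_factorial]; congr 1; ring
  have f1 : ((n - j).factorial : ℂ) ≠ 0 := by exact_mod_cast (n - j).factorial_ne_zero
  have f2 : (j.factorial : ℂ) ≠ 0 := by exact_mod_cast j.factorial_ne_zero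
  have hW := (hG1.fun_inv (by rw [v1]; exact f1)).mul (hG2.fun_inv (by rw [v2]; exact f2))
  have hF := (hG1.const_mul ((n.factorial : ℂ) ^ (b + 2))).mul (hW.pow (b + 2))
  refine hF.congr_deriv ?_
  have hch : (n.choose j : ℂ) = n.factorial / (j.factorial * (n - j).factorial) := by
    rw [Nat.cast_choose ℂ hj]
  simp only [Pi.mul_apply, Pi.pow_apply, v1, v2, hch]
  rw [show b + 2 - 1 = b + 1 by omega]
  push_cast
  generalize ((n - j).factorial : ℂ) = A at *
  generalize (j.factorial : ℂ) = B at *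
  simp only [mul_pow, inv_pow, div_pow, pow_add]
  field_simp
  ring

/-- The entire function `sin(π z) / z`. -/
noncomputable def sinQuot : ℂ → ℂ := dslope (fun z => sin (Real.pi * z)) 0

theorem sinQuot_mul (z : ℂ) : z * sinQuot z = sin (Real.pi * z) := by
  have := sub_smul_dslope (fun z => sin (Real.pi * z)) 0 z
  simpa [sinQuot] using this

theorem differentiable_sinQuot : Differentiable ℂ sinQuot := by
  rw [← differentiableOn_univ]
  refine (differentiableOn_dslope Filter.univ_mem).mpr ?_
  fun_prop

theorem sinQuot_zero : sinQuot 0 = Real.pi := by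
  rw [sinQuot, dslope_same]
  have : HasDerivAt (fun z : ℂ => sin (Real.pi * z)) (cos (Real.pi * 0) * (Real.pi * 1)) 0 :=
    ((hasDerivAt_id (0 : ℂ)).const_mul (Real.pi : ℂ)).csin
  rw [this.deriv]; simp

theorem sinQuot_neg (z : ℂ) : sinQuot (-z) = sinQuot z := by
  rcases eq_or_ne z 0 with rfl | hz
  · simp
  · have h1 := sinQuot_mul z
    have h2 := sinQuot_mul (-z)
    rw [mul_neg, sin_neg, ← h1] at h2
    exact mul_left_cancel₀ hz (by linear_combination -h2)

theorem deriv_sinQuot_zero : deriv sinQuot 0 = 0 := by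
  have h : deriv (fun z => sinQuot (-z)) 0 = -deriv sinQuot (-0) := deriv_comp_neg _ _
  simp only [sinQuot_neg, neg_zero] at h
  have : deriv sinQuot 0 = -deriv sinQuot 0 := h
  exact self_eq_neg.mp this

theorem sin_pi_mul_ne_zero_of_abs_re_lt_one {z : ℂ} (hz : z ≠ 0) (hre : |z.re| < 1) :
    sin (Real.pi * z) ≠ 0 := by
  have hpi : (Real.pi : ℂ) ≠ 0 := by exact_mod_cast Real.pi_ne_zero
  intro h
  obtain ⟨k, hk⟩ := sin_eq_zero_iff.mp h
  have hzk : z = k := mul_left_cancel₀ hpi (by rw [hk]; ring)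
  rw [hzk, intCast_re] at hre
  have : k = 0 := by
    rw [← Int.abs_lt_one_iff]; exact_mod_cast hre
  exact hz (by simp [hzk, this])

theorem sinQuot_ne_zero {z : ℂ} (hre : |z.re| < 1) : sinQuot z ≠ 0 := by
  rcases eq_or_ne z 0 with rfl | hz
  · rw [sinQuot_zero]; exact_mod_cast Real.pi_ne_zero
  · intro h
    apply sin_pi_mul_ne_zero_of_abs_re_lt_one hz hre
    rw [← sinQuot_mul, h, mul_zero]

theorem risingProd_ne_zero_of_strip {j : ℕ} (hre : |(s + j).re| < 1) (hs : s ≠ -j) :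
    risingProd n s ≠ 0 := by
  rw [risingProd_ne_zero_iff]
  intro k _ hk
  have hsk : s = -k := by linear_combination hk
  rw [hsk] at hre hs
  apply hs
  have : |(j : ℤ) - k| < 1 := by
    have : ((-k : ℂ) + j).re = ((j - k : ℤ) : ℝ) := by push_cast; simp; ring
    rw [this] at hre
    exact_mod_cast hre
  rw [Int.abs_lt_one_iff] at this
  have : j = k := by omega
  rw [this]

theorem rectIntegral_residueKernel_strip {j : ℕ} (hj : j ≤ n) {x₀ x₁ h : ℝ} (hh : 0 < h)
    (hx₀ : -(j : ℝ) - 1 < x₀) (hx₀' : x₀ < -j) (hx₁ : -(j : ℝ) < x₁) (hx₁' : x₁ < -j + 1) :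
    rectIntegral (residueKernel b n) x₀ x₁ h =
      2 * Real.pi * I * deriv (interpolant b n) (-j) := by
  set U : Set ℂ := {s | |(s + j).re| < 1} with hU
  have hUo : IsOpen U := isOpen_lt (by fun_prop) continuous_const
  have hUre : ∀ s ∈ U, -(n + 1 : ℝ) < s.re := by
    intro s hs
    have h1 := (abs_lt.mp (show |(s + j).re| < 1 from hs)).1
    have : (j : ℝ) ≤ n := by exact_mod_cast hj
    simp at h1
    linarith
  set D : ℂ → ℂ := fun s => interpolant b n s * (Real.pi / sinQuot (s + j)) ^ 2 with hDdef
  have hQ : ∀ s ∈ U, DifferentiableAt ℂ (fun s : ℂ => sinQuot (s + j)) s := fun s _ =>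
    (differentiable_sinQuot _).comp s (by fun_prop)
  have hD : DifferentiableOn ℂ D U := fun s hs =>
    ((differentiableAt_interpolant (hUre s hs)).mul
      (((differentiableAt_const _).div (hQ s hs) (sinQuot_ne_zero hs)).pow 2)).differentiableWithinAt
  have hjU : (-j : ℂ) ∈ U := by simp [hU]
  have hder : deriv D ((-j : ℝ) : ℂ) = deriv (interpolant b n) (-j) := by
    push_cast
    have h1 := (differentiableAt_interpolant (b := b) (hUre _ hjU)).hasDerivAt
    have h2 : HasDerivAt (fun s : ℂ => sinQuot (s + j)) 0 (-j) := by
      have := (differentiable_sinQuot ((-j : ℂ) + j)).hasDerivAt.comp_add_const (-j : ℂ) (j : ℂ)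
      rwa [neg_add_cancel, deriv_sinQuot_zero] at this
    have hne : sinQuot ((-j : ℂ) + j) ≠ 0 := sinQuot_ne_zero hjU
    have h3 := h1.mul ((((hasDerivAt_const _ (Real.pi : ℂ)).fun_div h2 hne)).fun_pow 2)
    have hpi : (Real.pi : ℂ) ≠ 0 := by exact_mod_cast Real.pi_ne_zero
    refine (h3.congr_deriv ?_).deriv
    simp [sinQuot_zero, hpi]
  rw [← hder]
  refine rectIntegral_of_double_pole hUo ?_ hD hx₀' hx₁ hh ?_
  · intro s hs
    have h1 := hs.1
    rw [Set.mem_preimage, Set.uIcc_of_le (by linarith)] at h1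
    simp only [hU, Set.mem_ofPred_eq, add_re, natCast_re, abs_lt]
    constructor <;> linarith [h1.1, h1.2]
  · intro s hs hsj
    push_cast at hsj ⊢
    have hz : s + j ≠ 0 := fun h => hsj (by linear_combination h)
    have hsin := sin_pi_mul_ne_zero_of_abs_re_lt_one hz hs
    have hsin' : sin (Real.pi * (s + j)) = (-1) ^ j * sin (Real.pi * s) := by
      rw [mul_add, mul_comm (Real.pi : ℂ) (j : ℂ)]
      exact sin_antiperiodic.add_nat_mul_eq j
    have hss : sin (Real.pi * s) ≠ 0 := fun h => hsin (by rw [hsin', h, mul_zero])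
    have hsq : sin (Real.pi * s) ^ 2 = ((s + j) * sinQuot (s + j)) ^ 2 := by
      rw [sinQuot_mul, hsin', mul_pow, ← pow_mul, mul_comm j 2, pow_mul]; simp
    have hq := sinQuot_ne_zero hs
    rw [residueKernel_eq_interpolant_mul (risingProd_ne_zero_of_strip hs hsj) hss, div_pow, hsq,
      sub_neg_eq_add, hDdef]
    field_simp

theorem risingProd_ne_zero_of_im (hs : s.im ≠ 0) : risingProd n s ≠ 0 :=
  risingProd_ne_zero_iff.mpr fun k _ h => hs (by simpa using congrArg im h)

theorem risingProd_ne_zero_of_re_pos (hs : 0 < s.re) : risingProd n s ≠ 0 :=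
  risingProd_ne_zero_iff.mpr fun k _ h => by
    have := congrArg re h
    simp at this
    linarith [Nat.cast_nonneg (α := ℝ) k]

theorem rectIntegral_residueKernel {m : ℕ} (hm : m < n) {c h : ℝ} (hc : 1 / 2 ≤ c) (hh : 0 < h) :
    rectIntegral (residueKernel b n) (-(m : ℝ) - 1 / 2) c h =
      2 * Real.pi * I * ∑ j ∈ Finset.range (m + 1), deriv (interpolant b n) (-j) := by
  have hmn : (m : ℝ) + 1 ≤ n := by exact_mod_cast hm
  have hside : ∀ (t₀ t₁ y : ℝ), y ≠ 0 → -(m : ℝ) - 1 / 2 ≤ t₀ → t₀ ≤ t₁ →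
      IntervalIntegrable (fun t : ℝ => residueKernel b n (t + y * I))
        MeasureTheory.volume t₀ t₁ := by
    intro t₀ t₁ y hy h0 h1
    refine ContinuousOn.intervalIntegrable fun t ht => ?_
    rw [Set.uIcc_of_le h1] at ht
    refine ContinuousAt.continuousWithinAt (ContinuousAt.comp (f := fun t : ℝ => (t + y * I : ℂ))
      (g := residueKernel b n) ?_ (by fun_prop))
    refine (differentiableAt_residueKernel ?_ (risingProd_ne_zero_of_im (by simpa))).continuousAt
    simp
    linarith [ht.1]
  have hsum := sum_rectIntegral (f := residueKernel b n) (h := h)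
    (x := fun k => 1 / 2 - (k : ℝ)) (M := m + 1)
    (fun k hk => hside _ _ _ (by linarith) (by
      have : (k : ℝ) + 1 ≤ m + 1 := by exact_mod_cast hk
      push_cast; linarith) (by push_cast; linarith))
    (fun k hk => hside _ _ _ (by linarith) (by
      have : (k : ℝ) + 1 ≤ m + 1 := by exact_mod_cast hk
      push_cast; linarith) (by push_cast; linarith))
  rw [Finset.sum_congr rfl fun k hk => rectIntegral_residueKernel_strip (b := b) (n := n)
    (j := k) (by have := Finset.mem_range.mp hk; omega) hh (by push_cast; linarith)
    (by push_cast; linarith) (by linarith) (by linarith),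
    ← Finset.mul_sum] at hsum
  rw [hsum]
  have hright : rectIntegral (residueKernel b n) (1 / 2) c h = 0 := by
    refine rectIntegral_eq_zero_of_differentiableOn fun s hs => ?_
    have h1 := hs.1
    rw [Set.mem_preimage, Set.uIcc_of_le hc] at h1
    exact (differentiableAt_residueKernel (by linarith [h1.1])
      (risingProd_ne_zero_of_re_pos (by linarith [h1.1]))).differentiableWithinAt
  have hm0 : (0 : ℝ) ≤ m := Nat.cast_nonneg m
  have hadd := sum_rectIntegral (f := residueKernel b n) (h := h)
    (x := fun k => if k = 0 then c else if k = 1 then 1 / 2 else -(m : ℝ) - 1 / 2) (M := 2)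
    (fun k hk => by
      interval_cases k <;> exact hside _ _ _ (by linarith) (by simp; try linarith)
        (by simp; linarith))
    (fun k hk => by
      interval_cases k <;> exact hside _ _ _ (by linarith) (by simp; try linarith)
        (by simp; linarith))
  simp only [Finset.sum_range_succ, Finset.sum_range_zero] at hadd
  norm_num at hadd hright ⊢
  rw [← hadd, hright, zero_add]
  congr 1
  ring

end

theorem phase_add_one_sub_le {x y : ℝ} (h : 0 < x ∨ 0 < y) :
    (-(1 / 2) ≤ x → phase 0 (x + 1) y - phase 0 x y ≤ Real.log ‖(⟨x + 1, y⟩ : ℂ)‖) ∧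
    (x ≤ -(1 / 2) → phase 0 (x + 1) y - phase 0 x y ≤ Real.log ‖(⟨x, y⟩ : ℂ)‖) := by
  have hslit : ∀ t : ℝ, x ≤ t → (⟨t, y⟩ : ℂ) ∈ Complex.slitPlane := fun t ht =>
    Complex.mem_slitPlane_iff.mpr (h.imp (fun h => h.trans_le ht) fun h => h.ne')
  obtain ⟨t, ht, hd⟩ := exists_hasDerivAt_eq_slope (fun x => phase 0 x y)
    (fun x => Real.log ‖(⟨x, y⟩ : ℂ)‖) (lt_add_one x)
    (fun t ht => (hasDerivAt_phase 0 (hslit t ht.1)).continuousAt.continuousWithinAt)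
    (fun t ht => hasDerivAt_phase 0 (hslit t ht.1.le))
  rw [add_sub_cancel_left, div_one] at hd
  have hpos : 0 < ‖(⟨t, y⟩ : ℂ)‖ := norm_pos_iff.mpr (Complex.slitPlane_ne_zero (hslit t ht.1.le))
  have hle : ∀ r : ℝ, t ^ 2 ≤ r ^ 2 → ‖(⟨t, y⟩ : ℂ)‖ ≤ ‖(⟨r, y⟩ : ℂ)‖ := by
    intro r hr
    rw [Complex.norm_def, Complex.norm_def]
    apply Real.sqrt_le_sqrt
    simp only [Complex.normSq_mk]
    nlinarith
  rw [← hd]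
  obtain ⟨h1, h2⟩ := ht
  exact ⟨fun hx => Real.log_le_log hpos (hle _ (by nlinarith)),
    fun hx => Real.log_le_log hpos (hle _ (by nlinarith))⟩

/-- A lower bound of Stirling type for the logarithm of a rising product. -/
theorem phase_sub_le_sum_log {x y A : ℝ} (h : 0 < x ∨ 0 < y)
    (hlog : ∀ k : ℕ, -A ≤ Real.log ‖(⟨x + k, y⟩ : ℂ)‖) (n : ℕ) :
    phase 0 (x + n) y - phase 0 x y - A ≤
      ∑ k ∈ Finset.range (n + 1), Real.log ‖(⟨x + k, y⟩ : ℂ)‖ := by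
  suffices H : (phase 0 (x + n) y - phase 0 x y - A ≤
        ∑ k ∈ Finset.range (n + 1), Real.log ‖(⟨x + k, y⟩ : ℂ)‖) ∧
      (x + n ≤ 1 / 2 → phase 0 (x + n) y - phase 0 x y ≤
        ∑ k ∈ Finset.range n, Real.log ‖(⟨x + k, y⟩ : ℂ)‖) from H.1
  induction n with
  | zero => simpa using hlog 0
  | succ n ih =>
    have hstep := phase_add_one_sub_le (x := x + n)
      (h.imp (fun h => by positivity) id)
    have hl := hlog (n + 1)
    rw [Finset.sum_range_succ _ (n + 1)]
    push_cast at hl ⊢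
    rw [← add_assoc] at hl ⊢
    rcases le_total (x + n) (-(1 / 2)) with hx | hx
    · have h1 := ih.2 (by linarith)
      have h2 := hstep.2 hx
      have h3 : phase 0 (x + n + 1) y - phase 0 x y ≤
          ∑ k ∈ Finset.range (n + 1), Real.log ‖(⟨x + k, y⟩ : ℂ)‖ := by
        rw [Finset.sum_range_succ]; linarith
      exact ⟨by linarith, fun _ => h3⟩
    · have h2 := hstep.1 hx
      refine ⟨by linarith [ih.1], fun hx' => ?_⟩
      have hx'' : x + n = -(1 / 2) := by linarith
      have h1 := ih.2 (by linarith)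
      have h2 := hstep.2 hx''.le
      rw [Finset.sum_range_succ]
      linarith

theorem log_factorial_le {n : ℕ} (hn : 1 ≤ n) :
    Real.log n.factorial ≤ n * Real.log n - n + Real.log n + 1 := by
  induction n, hn using Nat.le_induction with
  | base => simp
  | succ n hn ih =>
    have hn0 : (0 : ℝ) < n := by exact_mod_cast hn
    have hf : (0 : ℝ) < n.factorial := by exact_mod_cast n.factorial_pos
    rw [Nat.factorial_succ]
    push_cast
    rw [Real.log_mul (by positivity) hf.ne']
    have h := Real.one_sub_inv_le_log_of_pos (x := ((n : ℝ) + 1) / n) (by positivity)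
    rw [Real.log_div (by positivity) hn0.ne', inv_div] at h
    have h2 : 1 ≤ (n + 1) * (Real.log (n + 1) - Real.log n) := by
      have := mul_le_mul_of_nonneg_left h (show (0 : ℝ) ≤ n + 1 by positivity)
      refine le_trans (le_of_eq ?_) this
      field_simp
      ring
    nlinarith

theorem arg_le_div {x y : ℝ} (hx : 0 < x) (hy : 0 ≤ y) :
    Complex.arg ⟨x, y⟩ ≤ y / x := by
  have h0 : 0 ≤ Complex.arg ⟨x, y⟩ := Complex.arg_nonneg_iff.mpr hy
  have h1 : Complex.arg ⟨x, y⟩ < Real.pi / 2 :=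
    (abs_lt.mp (Complex.abs_arg_lt_pi_div_two_iff.mpr (Or.inl hx))).2
  have := Real.le_tan h0 h1
  rwa [Complex.tan_arg] at this

theorem le_phase_add {n u v : ℝ} (hn : 0 < n) (hu : -(n / 2) ≤ u) (hv : 0 ≤ v) :
    n * Real.log n - n + u * Real.log n - 2 * v ^ 2 / n ≤ phase 0 (u + n) v := by
  have hx : 0 < u + n := by linarith
  have h1 : Real.log (u + n) ≤ Real.log ‖(⟨u + n, v⟩ : ℂ)‖ := by
    refine Real.log_le_log hx ?_
    exact (le_abs_self _).trans (Complex.abs_re_le_norm (⟨u + n, v⟩ : ℂ))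
  have h2 : v * Complex.arg ⟨u + n, v⟩ ≤ 2 * v ^ 2 / n := by
    have h3 : v / (u + n) ≤ v / (n / 2) := div_le_div_of_nonneg_left hv (by linarith) (by linarith)
    calc v * Complex.arg ⟨u + n, v⟩ ≤ v * (v / (n / 2)) :=
          mul_le_mul_of_nonneg_left ((arg_le_div hx hv).trans h3) hv
      _ = 2 * v ^ 2 / n := by field_simp
  have h4 : u ≤ (u + n) * (Real.log (u + n) - Real.log n) := by
    have := Real.one_sub_inv_le_log_of_pos (x := (u + n) / n) (by positivity)
    rw [Real.log_div hx.ne' hn.ne', inv_div] at this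
    refine le_trans (le_of_eq ?_) (mul_le_mul_of_nonneg_left this hx.le)
    field_simp
    ring
  have h5 := mul_le_mul_of_nonneg_left h1 hx.le
  unfold phase
  linarith

theorem log_Gamma_add_le {n : ℕ} {u : ℝ} (hn : 1 ≤ n) (hu : |u| ≤ n / 2) :
    Real.log (Real.Gamma (n + 1 + u)) ≤
      Real.log n.factorial + u * Real.log n + 2 * (u ^ 2 + |u|) / n := by
  have hn0 : (0 : ℝ) < n := by exact_mod_cast hn
  have hc := Real.convexOn_log_Gamma
  have hf : ∀ x : ℝ, 0 < x → Real.log (Real.Gamma (x + 1)) - Real.log (Real.Gamma x) =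
      Real.log x := by
    intro x hx
    rw [Real.Gamma_add_one hx.ne', Real.log_mul hx.ne' (Real.Gamma_pos_of_pos hx).ne']
    ring
  have hlb := (abs_le.mp hu).1
  rw [← Real.Gamma_nat_eq_factorial]
  rcases lt_trichotomy u 0 with h | rfl | h
  · have h1 := hc.slope_mono_adjacent (x := n + u) (y := n + u + 1) (z := n + 1)
      (show (0 : ℝ) < n + u by linarith) (show (0 : ℝ) < n + 1 by linarith) (by linarith)
      (by linarith)
    simp only [Function.comp] at h1
    rw [hf _ (by linarith), show (n : ℝ) + u + 1 - (n + u) = 1 by ring, div_one,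
      le_div_iff₀ (by linarith)] at h1
    have h2 := Real.one_sub_inv_le_log_of_pos (x := (n + u) / n)
      (div_pos (by linarith) hn0)
    rw [Real.log_div (by linarith) hn0.ne', inv_div] at h2
    have h3 : 2 * u / n ≤ 1 - n / (n + u) := by
      rw [one_sub_div (by linarith), div_le_div_iff₀ hn0 (by linarith)]
      nlinarith
    have h4 : u * Real.log (n + u) ≤ u * (Real.log n + 2 * u / n) :=
      mul_le_mul_of_nonpos_left (by linarith) h.le
    have h5 : u * (Real.log n + 2 * u / n) ≤ u * Real.log n + 2 * (u ^ 2 + |u|) / n := by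
      have : 0 ≤ 2 * |u| / n := by positivity
      calc _ = u * Real.log n + 2 * u ^ 2 / n := by ring
        _ ≤ u * Real.log n + 2 * u ^ 2 / n + 2 * |u| / n := by linarith
        _ = _ := by ring
    rw [show (n : ℝ) + u + 1 = n + 1 + u by ring] at h1
    linarith
  · simp
  · have h1 := hc.slope_mono_adjacent (x := n + 1) (y := n + 1 + u) (z := n + 1 + u + 1)
      (show (0 : ℝ) < n + 1 by linarith) (show (0 : ℝ) < n + 1 + u + 1 by linarith) (by linarith)
      (by linarith)
    simp only [Function.comp] at h1
    rw [hf _ (by linarith), show (n : ℝ) + 1 + u + 1 - (n + 1 + u) = 1 by ring, div_one,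
      div_le_iff₀ (by linarith)] at h1
    have h2 := Real.log_le_sub_one_of_pos (x := (n + 1 + u) / n) (by positivity)
    rw [Real.log_div (by positivity) hn0.ne'] at h2
    have h4 : Real.log (n + 1 + u) * u ≤ (Real.log n + (1 + u) / n) * u := by
      refine mul_le_mul_of_nonneg_right ?_ h.le
      have : (n + 1 + u) / n - 1 = (1 + u) / n := by field_simp; ring
      linarith
    have h5 : (Real.log n + (1 + u) / n) * u ≤ u * Real.log n + 2 * (u ^ 2 + |u|) / n := by
      rw [abs_of_pos h]
      have : 0 ≤ (u ^ 2 + u) / n := by positivity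
      calc _ = u * Real.log n + (u ^ 2 + u) / n := by ring
        _ ≤ u * Real.log n + (u ^ 2 + u) / n + (u ^ 2 + u) / n := by linarith
        _ = _ := by ring
    linarith

theorem norm_Gamma_le {s : ℂ} (hs : 0 < s.re) : ‖Complex.Gamma s‖ ≤ Real.Gamma s.re := by
  rw [Complex.Gamma_eq_integral hs, Real.Gamma_eq_integral hs, Complex.GammaIntegral]
  refine (MeasureTheory.norm_integral_le_integral_norm _).trans (le_of_eq ?_)
  refine MeasureTheory.setIntegral_congr_fun measurableSet_Ioi fun x hx => ?_
  simp [Complex.norm_cpow_eq_rpow_re_of_pos hx, Complex.norm_exp]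

theorem norm_sin_le_exp (z : ℂ) : ‖Complex.sin z‖ ≤ Real.exp |z.im| := by
  rw [Complex.sin]
  have h1 : ‖Complex.exp (-z * Complex.I)‖ ≤ Real.exp |z.im| := by
    rw [Complex.norm_exp]
    simpa using le_abs_self _
  have h2 : ‖Complex.exp (z * Complex.I)‖ ≤ Real.exp |z.im| := by
    rw [Complex.norm_exp]
    simpa using neg_le_abs _
  rw [norm_div, norm_mul, Complex.norm_I, mul_one, Complex.norm_ofNat]
  linarith [norm_sub_le (Complex.exp (-z * Complex.I)) (Complex.exp (z * Complex.I))]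

theorem phase_mul {N x y : ℝ} (β : ℝ) (hN : 0 < N) (h : (⟨x, y⟩ : ℂ) ≠ 0) :
    phase 0 (N * x) (N * y) = N * (phase β x y - y * β) + N * x * Real.log N := by
  have hz : (⟨N * x, N * y⟩ : ℂ) = (N : ℂ) * ⟨x, y⟩ := by apply Complex.ext <;> simp
  unfold phase
  rw [hz, Complex.arg_real_mul _ hN, norm_mul, Complex.norm_real, Real.norm_eq_abs,
    abs_of_pos hN, Real.log_mul hN.ne' (norm_ne_zero_iff.mpr h)]
  ring

theorem norm_mk_abs (x y : ℝ) : ‖(⟨x, |y|⟩ : ℂ)‖ = ‖(⟨x, y⟩ : ℂ)‖ := by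
  simp [Complex.norm_def, Complex.normSq_mk]

theorem log_norm_risingProd {n : ℕ} {s : ℂ} (hs : risingProd n s ≠ 0) :
    Real.log ‖risingProd n s‖ =
      ∑ k ∈ Finset.range (n + 1), Real.log ‖(⟨s.re + k, |s.im|⟩ : ℂ)‖ := by
  have h := fun k hk => risingProd_ne_zero_iff.mp hs k hk
  rw [risingProd, norm_prod, Real.log_prod fun k hk =>
    norm_ne_zero_iff.mpr (h k (by have := Finset.mem_range.mp hk; omega))]
  refine Finset.sum_congr rfl fun k _ => ?_
  rw [norm_mk_abs]
  congr 2
  apply Complex.ext <;> simp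

/-- The main bound for `residueKernel` in terms of `phase`. -/
theorem norm_residueKernel_le {b n : ℕ} {N x y A : ℝ} {s : ℂ} (hn : 1 ≤ n) (hN : 0 < N)
    (hNn : (b + 2 : ℝ) * Real.log N = (b + 1) * Real.log n) (hx : s.re = N * x)
    (hy : |s.im| = N * y) (hxy : 0 < x ∨ 0 < y) (hu : |s.re| ≤ n / 2)
    (hlog : ∀ k : ℕ, -A ≤ Real.log ‖(⟨s.re + k, |s.im|⟩ : ℂ)‖) :
    ‖residueKernel b n s‖ ≤ n.factorial *
      Real.exp ((b + 2) * N * phase (Real.pi - 2 * Real.pi / (b + 2)) x y +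
        (2 * (s.re ^ 2 + |s.re|) / n + (b + 2) * (Real.log n + 1 + A + 2 * s.im ^ 2 / n))) := by
  have hn0 : (0 : ℝ) < n := by exact_mod_cast hn
  have hf : (0 : ℝ) < n.factorial := by exact_mod_cast n.factorial_pos
  have hxy' : 0 < s.re ∨ 0 < |s.im| := by
    rw [hx, hy]; exact hxy.imp (mul_pos hN) (mul_pos hN)
  have hz : (⟨x, y⟩ : ℂ) ≠ 0 := fun h => by
    have h1 := congrArg Complex.re h
    have h2 := congrArg Complex.im h
    simp only [Complex.zero_re, Complex.zero_im] at h1 h2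
    rcases hxy with h | h <;> linarith
  have hP : risingProd n s ≠ 0 := hxy'.elim risingProd_ne_zero_of_re_pos fun h =>
    risingProd_ne_zero_of_im (abs_pos.mp h)
  have hPpos : 0 < ‖risingProd n s‖ := norm_pos_iff.mpr hP
  have hub := (abs_le.mp hu).1
  have hG : ‖Complex.Gamma (n + 1 + s)‖ ≤ Real.exp (Real.log n.factorial + s.re * Real.log n +
      2 * (s.re ^ 2 + |s.re|) / n) := by
    have hre : (n + 1 + s : ℂ).re = n + 1 + s.re := by simp
    have hpos : 0 < (n : ℝ) + 1 + s.re := by linarith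
    refine (norm_Gamma_le (by rw [hre]; exact hpos)).trans ?_
    rw [hre, ← Real.log_le_iff_le_exp (Real.Gamma_pos_of_pos hpos)]
    exact log_Gamma_add_le hn hu
  have hsin : ‖Complex.sin (Real.pi * s) / Real.pi‖ ≤ Real.exp (Real.pi * |s.im|) := by
    rw [norm_div, Complex.norm_real, Real.norm_eq_abs, abs_of_pos Real.pi_pos]
    refine (div_le_self (norm_nonneg _) (by linarith [Real.pi_gt_three])).trans ?_
    refine (norm_sin_le_exp _).trans (le_of_eq ?_)
    rw [Complex.im_ofReal_mul, abs_mul, abs_of_pos Real.pi_pos]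
  have hprod : n.factorial / ‖risingProd n s‖ ≤ Real.exp (Real.log n + 1 + A +
      2 * s.im ^ 2 / n - s.re * Real.log n + phase 0 s.re |s.im|) := by
    rw [← Real.log_le_iff_le_exp (by positivity), Real.log_div hf.ne' hPpos.ne',
      log_norm_risingProd hP]
    have h1 := phase_sub_le_sum_log hxy' hlog n
    have h2 := le_phase_add hn0 (u := s.re) (v := |s.im|) (by linarith) (abs_nonneg _)
    rw [sq_abs] at h2
    linarith [log_factorial_le hn]
  rw [residueKernel_eq hP, norm_mul, norm_mul, norm_pow, norm_pow, norm_div, Complex.norm_natCast]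
  have hb : (b + 2 : ℝ) ≠ 0 := by positivity
  calc ‖Complex.Gamma (n + 1 + s)‖ * (n.factorial / ‖risingProd n s‖) ^ (b + 2) *
        ‖Complex.sin (Real.pi * s) / Real.pi‖ ^ b
      ≤ Real.exp (Real.log n.factorial + s.re * Real.log n + 2 * (s.re ^ 2 + |s.re|) / n) *
        Real.exp (Real.log n + 1 + A + 2 * s.im ^ 2 / n - s.re * Real.log n +
          phase 0 s.re |s.im|) ^ (b + 2) * Real.exp (Real.pi * |s.im|) ^ b := by
        gcongr
    _ = n.factorial * Real.exp ((b + 2) * N * phase (Real.pi - 2 * Real.pi / (b + 2)) x y +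
        (2 * (s.re ^ 2 + |s.re|) / n +
          (b + 2) * (Real.log n + 1 + A + 2 * s.im ^ 2 / n))) := by
        have hexp : ∀ t, (n.factorial : ℝ) * Real.exp t =
            Real.exp (Real.log n.factorial + t) := fun t => by
          rw [Real.exp_add, Real.exp_log hf]
        rw [hexp, ← Real.exp_nat_mul, ← Real.exp_nat_mul, ← Real.exp_add, ← Real.exp_add]
        congr 1
        rw [hy, hx, phase_mul (Real.pi - 2 * Real.pi / (b + 2)) hN hz]
        have hβ : (b + 2) * (Real.pi - 2 * Real.pi / (b + 2)) = Real.pi * b := by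
          field_simp; ring
        push_cast
        linear_combination (N * x) * hNn - (N * y) * hβ

theorem phase_le_of_le_neg_eight {β x y : ℝ} (hβ : |β| ≤ Real.pi) (hx : x ≤ -8) (hy0 : 0 ≤ y)
    (hy : y ≤ 1) : phase β x y ≤ -1 := by
  unfold phase
  have h1 : 8 ≤ ‖(⟨x, y⟩ : ℂ)‖ := by
    refine le_trans ?_ (Complex.abs_re_le_norm _)
    rw [abs_of_nonpos (by linarith)]
    linarith
  have h2 : 2 ≤ Real.log ‖(⟨x, y⟩ : ℂ)‖ := by
    have h8 : Real.log 8 = 3 * Real.log 2 := by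
      rw [show (8 : ℝ) = 2 ^ 3 by norm_num, Real.log_pow]; norm_num
    have := Real.log_le_log (by norm_num) h1
    linarith [Real.log_two_gt_d9]
  have h3 : 0 ≤ Complex.arg ⟨x, y⟩ := Complex.arg_nonneg_iff.mpr hy0
  have h4 := (abs_le.mp hβ).2
  have h5 : y * (β - Complex.arg ⟨x, y⟩) ≤ 1 * Real.pi := by
    refine (mul_le_mul_of_nonneg_left (show _ ≤ Real.pi by linarith) hy0).trans ?_
    exact mul_le_mul_of_nonneg_right hy Real.pi_pos.le
  nlinarith [Real.pi_lt_four]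

/-- The maximum of `residueKernel` over the contour. -/
theorem norm_residueKernel_le_of_mem_rectBoundary {b n m : ℕ} {N κ η θ : ℝ} (hn : 1 ≤ n)
    (hN : 1 ≤ N) (hNn : (b + 2 : ℝ) * Real.log N = (b + 1) * Real.log n)
    (hm : 8 * N ≤ m) (hm' : (m : ℝ) ≤ 8 * N + 1) (hmn : (m : ℝ) + 1 / 2 ≤ n / 2)
    (hκ : κ ≤ 1) (hη : η ≤ 1) (hκN : 1 ≤ κ * N) (hηN : 1 ≤ η * N) (hθ : -1 ≤ θ)
    (hright : ∀ y, 0 ≤ y → y ≤ η → phase (Real.pi - 2 * Real.pi / (b + 2)) κ y ≤ θ)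
    (htop : ∀ x, x ≤ κ → phase (Real.pi - 2 * Real.pi / (b + 2)) x η ≤ θ) {s : ℂ}
    (hs : s ∈ rectBoundary (-(m : ℝ) - 1 / 2) (κ * N) (η * N)) :
    ‖residueKernel b n s‖ ≤ n.factorial * Real.exp ((b + 2) * N * θ +
      (4 * b + 240) * (Real.log n + N ^ 2 / n + 1)) := by
  have hn0 : (0 : ℝ) < n := by exact_mod_cast hn
  have hN0 : 0 < N := by linarith
  have hκN' : κ * N ≤ N := by nlinarith
  have hηN' : η * N ≤ N := by nlinarith
  set β := Real.pi - 2 * Real.pi / (b + 2 : ℝ) with hβdef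
  have hβ : |β| ≤ Real.pi := by
    have h1 : 2 * Real.pi / (b + 2 : ℝ) ≤ Real.pi := by
      rw [div_le_iff₀ (by positivity)]
      nlinarith [Real.pi_pos, Nat.cast_nonneg (α := ℝ) b]
    have h2 : 0 ≤ 2 * Real.pi / (b + 2 : ℝ) := by positivity
    rw [abs_le]; constructor <;> linarith [Real.pi_pos]
  have H : ∀ s : ℂ, |s.re| ≤ m + 1 / 2 → |s.im| ≤ N → (0 < s.re ∨ 0 < |s.im|) →
      (∀ k : ℕ, 1 / 2 ≤ ‖(⟨s.re + k, |s.im|⟩ : ℂ)‖) → phase β (s.re / N) (|s.im| / N) ≤ θ →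
      ‖residueKernel b n s‖ ≤ n.factorial * Real.exp ((b + 2) * N * θ +
        (4 * b + 240) * (Real.log n + N ^ 2 / n + 1)) := by
    intro s hre him hpos hnorm hphase
    refine (norm_residueKernel_le (N := N) (x := s.re / N) (y := |s.im| / N) (A := 1) hn hN0 hNn
      (by field_simp) (by field_simp) (hpos.imp (fun h => by positivity) fun h => by positivity)
      (by linarith) fun k => ?_).trans ?_
    · have h1 := Real.log_le_log (by norm_num) (hnorm k)
      rw [one_div, Real.log_inv] at h1
      linarith [Real.log_two_lt_d9]
    · refine mul_le_mul_of_nonneg_left (Real.exp_le_exp.mpr (add_le_add ?_ ?_)) (by positivity)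
      · exact mul_le_mul_of_nonneg_left hphase (by positivity)
      · have h1 : |s.re| ≤ 10 * N := by linarith
        have h2 : s.re ^ 2 ≤ 100 * N ^ 2 := by
          rw [← sq_abs]; nlinarith [abs_nonneg s.re]
        have h3 : 2 * (s.re ^ 2 + |s.re|) / n ≤ 220 * (N ^ 2 / n) := by
          rw [← mul_div_assoc]
          exact div_le_div_of_nonneg_right (by nlinarith) hn0.le
        have h4 : 2 * s.im ^ 2 / n ≤ 2 * (N ^ 2 / n) := by
          rw [← mul_div_assoc, ← sq_abs s.im]
          gcongr
        have h5 : 0 ≤ Real.log n := Real.log_natCast_nonneg n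
        have h6 : 0 ≤ N ^ 2 / n := by positivity
        have h7 : (b + 2) * (Real.log n + 1 + 1 + 2 * s.im ^ 2 / n) ≤
            (b + 2) * (2 * (Real.log n + N ^ 2 / n + 1)) :=
          mul_le_mul_of_nonneg_left (by linarith) (by positivity)
        nlinarith [Nat.cast_nonneg (α := ℝ) b]
  obtain ⟨hre, him, hedge⟩ := hs
  rw [Set.uIcc_of_le (by linarith)] at hre him
  have hre' : |s.re| ≤ m + 1 / 2 := abs_le.mpr ⟨by linarith [hre.1], by linarith [hre.2]⟩
  have him' : |s.im| ≤ η * N := abs_le.mpr him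
  have hxκ : s.re / N ≤ κ := (div_le_iff₀ hN0).mpr hre.2
  have hyη : |s.im| / N ≤ η := (div_le_iff₀ hN0).mpr him'
  have htopcase : |s.im| = η * N → ‖residueKernel b n s‖ ≤ n.factorial *
      Real.exp ((b + 2) * N * θ + (4 * b + 240) * (Real.log n + N ^ 2 / n + 1)) := by
    intro h
    refine H s hre' (by linarith) (Or.inr (by linarith)) (fun k => ?_) ?_
    · have := Complex.abs_im_le_norm (⟨s.re + k, |s.im|⟩ : ℂ)
      simp only [abs_abs] at this
      linarith
    · rw [h, mul_div_cancel_right₀ _ hN0.ne']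
      exact htop _ hxκ
  have hleft : ∀ k : ℕ, 1 / 2 ≤ |-(m : ℝ) - 1 / 2 + k| := by
    intro k
    rcases le_or_gt k m with h | h
    · have : (k : ℝ) ≤ m := by exact_mod_cast h
      rw [abs_of_nonpos (by linarith)]; linarith
    · have : (m : ℝ) + 1 ≤ k := by exact_mod_cast h
      rw [abs_of_nonneg (by linarith)]; linarith
  have hleftcase : ∀ s : ℂ, s.re = -m - 1 / 2 → |s.im| ≤ N → 0 < |s.im| →
      ‖residueKernel b n s‖ ≤ n.factorial *
      Real.exp ((b + 2) * N * θ + (4 * b + 240) * (Real.log n + N ^ 2 / n + 1)) := by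
    intro s h him h0
    refine H s ?_ him (Or.inr h0) (fun k => ?_) ?_
    · rw [h, abs_of_nonpos (by linarith)]; linarith
    · have := Complex.abs_re_le_norm (⟨s.re + k, |s.im|⟩ : ℂ)
      simp only [h] at this ⊢
      exact (hleft k).trans this
    · refine (phase_le_of_le_neg_eight hβ ?_ (by positivity) ((div_le_one hN0).mpr him)).trans hθ
      rw [h, div_le_iff₀ hN0]; linarith
  rcases hedge with h | h | h | h
  · exact htopcase (by rw [h, abs_neg, abs_of_nonneg (by linarith)])
  · exact htopcase (by rw [h, abs_of_nonneg (by linarith)])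
  · refine H s hre' (by linarith) (Or.inl (by linarith)) (fun k => ?_) ?_
    · have := Complex.abs_re_le_norm (⟨s.re + k, |s.im|⟩ : ℂ)
      have h2 := le_abs_self (s.re + k)
      simp only at this
      linarith [Nat.cast_nonneg (α := ℝ) k]
    · rw [h, mul_div_cancel_right₀ _ hN0.ne']
      exact hright _ (by positivity) hyη
  · rcases eq_or_ne s.im 0 with h0 | h0
    · have hP : risingProd n s ≠ 0 := risingProd_ne_zero_iff.mpr fun k _ hk => by
        have h1 := congrArg Complex.re hk
        simp only [Complex.add_re, Complex.natCast_re, Complex.zero_re, h] at h1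
        have h2 := hleft k
        rw [h1, abs_zero] at h2
        linarith
      have hc : ContinuousAt (fun t : ℝ => ‖residueKernel b n (s + t * Complex.I)‖) 0 := by
        refine ContinuousAt.norm (ContinuousAt.comp
          (f := fun t : ℝ => (s + t * Complex.I : ℂ)) (g := residueKernel b n) ?_ (by fun_prop))
        simp only [Complex.ofReal_zero, zero_mul, add_zero]
        exact (differentiableAt_residueKernel (by linarith) hP).continuousAt
      have ht := hc.tendsto.mono_left (nhdsWithin_le_nhds (s := Set.Ioi 0))
      simp only [Complex.ofReal_zero, zero_mul, add_zero] at ht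
      refine le_of_tendsto ht ?_
      filter_upwards [Ioo_mem_nhdsGT hN0] with t ht
      have him2 : (s + t * Complex.I).im = t := by simp [h0]
      refine hleftcase _ (by simp [h]) ?_ ?_ <;> rw [him2, abs_of_pos ht.1]
      · exact ht.2.le
      · exact ht.1
    · exact hleftcase s h (by linarith) (abs_pos.mpr h0)

/-- The `j`-th summand of `p - γ q`, after the substitution `k = n - j`. -/
noncomputable def gammaTerm (b n j : ℕ) : ℝ :=
  (n.choose j : ℝ) ^ (b + 2) * (n - j).factorial *
    ((b + 2) * harmonic j - (b + 1) * harmonic (n - j) - Real.eulerMascheroniConstant)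

theorem deriv_interpolant {b n j : ℕ} (hj : j ≤ n) :
    deriv (interpolant b n) (-j) = (gammaTerm b n j : ℂ) := by
  rw [(hasDerivAt_interpolant hj).deriv, gammaTerm]
  push_cast
  rfl

theorem pseq1_sub_eq_sum_gammaTerm (b n : ℕ) :
    (pseq1 (b + 2) n : ℝ) - Real.eulerMascheroniConstant * (qseq (b + 2) n : ℝ) =
      ∑ j ∈ Finset.range (n + 1), gammaTerm b n j := by
  rw [← Finset.sum_range_reflect, pseq1, qseq]
  push_cast
  rw [Finset.mul_sum, ← Finset.sum_sub_distrib]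
  refine Finset.sum_congr rfl fun k hk => ?_
  have hk' : k ≤ n := by have := Finset.mem_range.mp hk; omega
  rw [gammaTerm, Nat.choose_symm hk', Nat.sub_sub_self hk']
  ring

theorem harmonic_le_self (n : ℕ) : harmonic n ≤ n := by
  have : harmonic n ≤ ∑ i ∈ Finset.range n, (1 : ℚ) := by
    refine Finset.sum_le_sum fun i _ => inv_le_one_of_one_le₀ ?_
    exact_mod_cast Nat.succ_pos i
  simpa using this

theorem harmonic_nonneg (n : ℕ) : 0 ≤ harmonic n :=
  Finset.sum_nonneg fun i _ => by positivity

theorem abs_harmonic_combination_le {b n j : ℕ} (hn : 1 ≤ n) (hj : j ≤ n) :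
    |(b + 2) * (harmonic j : ℝ) - (b + 1) * harmonic (n - j) - Real.eulerMascheroniConstant| ≤
      3 * (b + 2) * n := by
  have h1 : (harmonic j : ℝ) ≤ n :=
    (show (harmonic j : ℝ) ≤ j by exact_mod_cast harmonic_le_self j).trans (by exact_mod_cast hj)
  have h2 : (harmonic (n - j) : ℝ) ≤ n :=
    (show (harmonic (n - j) : ℝ) ≤ (n - j : ℕ) by exact_mod_cast harmonic_le_self (n - j)).trans
      (by exact_mod_cast Nat.sub_le n j)
  have h3 : (0 : ℝ) ≤ harmonic j := by exact_mod_cast harmonic_nonneg j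
  have h4 : (0 : ℝ) ≤ harmonic (n - j) := by exact_mod_cast harmonic_nonneg (n - j)
  have h5 := Real.one_half_lt_eulerMascheroniConstant
  have h6 := Real.eulerMascheroniConstant_lt_two_thirds
  have hn' : (1 : ℝ) ≤ n := by exact_mod_cast hn
  have hb : (0 : ℝ) ≤ b := Nat.cast_nonneg b
  have h7 : (b + 2) * (harmonic j : ℝ) ≤ (b + 2) * n := by gcongr
  have h8 : (b + 1) * (harmonic (n - j) : ℝ) ≤ (b + 1) * n := by gcongr
  have h9 : 0 ≤ (b + 2) * (harmonic j : ℝ) := by positivity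
  have h10 : 0 ≤ (b + 1) * (harmonic (n - j) : ℝ) := by positivity
  have h11 : 0 ≤ b * (n : ℝ) := by positivity
  rw [abs_le]
  constructor <;> linarith

theorem choose_pow_mul_factorial_eq {b n j : ℕ} (hj : j ≤ n) :
    (n.choose j : ℝ) ^ (b + 2) * (n - j).factorial =
      n.factorial * ((n.choose j : ℝ) ^ (b + 1) / j.factorial) := by
  have hj0 : (j.factorial : ℝ) ≠ 0 := by exact_mod_cast j.factorial_ne_zero
  have h : (n.choose j : ℝ) * j.factorial * (n - j).factorial = n.factorial := by
    exact_mod_cast Nat.choose_mul_factorial_mul_factorial hj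
  rw [← h]
  field_simp
  ring

theorem le_log_factorial {j : ℕ} (hj : 1 ≤ j) :
    j * Real.log j - j ≤ Real.log j.factorial := by
  have hj0 : (0 : ℝ) < j := by exact_mod_cast hj
  have hf : (0 : ℝ) < j.factorial := by exact_mod_cast j.factorial_pos
  have h := Real.log_le_log (by positivity) (Real.pow_div_factorial_le_exp j hj0.le j)
  rw [Real.log_exp, Real.log_div (by positivity) hf.ne', Real.log_pow] at h
  linarith

theorem abs_gammaTerm_le {b n j : ℕ} {N : ℝ} (hn : 1 ≤ n) (hj : j ≤ n) (hN : 1 ≤ N)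
    (hNn : (b + 2 : ℝ) * Real.log N = (b + 1) * Real.log n) (hNj : 8 * N ≤ j) :
    |gammaTerm b n j| ≤ n.factorial * Real.exp (-((b + 2) * N)) * (3 * (b + 2) * n) := by
  have hj1 : 1 ≤ j := by
    have : (1 : ℝ) ≤ j := by linarith
    exact_mod_cast this
  have hj0 : (0 : ℝ) < j := by exact_mod_cast hj1
  have hn0 : (0 : ℝ) < n := by exact_mod_cast hn
  have hf : (0 : ℝ) < j.factorial := by exact_mod_cast j.factorial_pos
  rw [gammaTerm, abs_mul]
  refine mul_le_mul ?_ (abs_harmonic_combination_le hn hj) (abs_nonneg _) (by positivity)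
  rw [abs_of_nonneg (by positivity), choose_pow_mul_factorial_eq hj]
  refine mul_le_mul_of_nonneg_left ?_ (by positivity)
  have hc : (n.choose j : ℝ) ^ (b + 1) / j.factorial ≤
      ((n : ℝ) ^ j / j.factorial) ^ (b + 1) / j.factorial := by
    gcongr
    exact Nat.choose_le_pow_div j n
  refine hc.trans ?_
  rw [← Real.log_le_iff_le_exp (by positivity), Real.log_div (by positivity) hf.ne', Real.log_pow,
    Real.log_div (by positivity) hf.ne', Real.log_pow]
  have h1 := le_log_factorial hj1
  have h2 : 2 + Real.log N ≤ Real.log j := by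
    have h8 : Real.log 8 = 3 * Real.log 2 := by
      rw [show (8 : ℝ) = 2 ^ 3 by norm_num, Real.log_pow]; norm_num
    have := Real.log_le_log (by positivity) hNj
    rw [Real.log_mul (by norm_num) (by positivity)] at this
    linarith [Real.log_two_gt_d9]
  push_cast
  have h3 : (b + 2) * (j * Real.log j - j) ≤ (b + 2) * Real.log j.factorial := by gcongr
  have h4 : (b + 2) * j * (2 + Real.log N) ≤ (b + 2) * j * Real.log j := by gcongr
  have h5 : (b + 2) * N ≤ (b + 2) * j := by gcongr; linarith
  have h6 : j * ((b + 2 : ℝ) * Real.log N) = j * ((b + 1) * Real.log n) := by rw [hNn]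
  linarith

theorem le_qseq {b n : ℕ} {N : ℝ} (hN : 1 ≤ N) (hNn' : 2 * N ≤ n)
    (hNn : (b + 2 : ℝ) * Real.log N = (b + 1) * Real.log n) :
    n.factorial * Real.exp ((b + 2) * N - 2 * (b + 2) * (Real.log n + N ^ 2 / n + 1)) ≤
      (qseq (b + 2) n : ℝ) := by
  have hn0 : (0 : ℝ) < n := by linarith
  have hn : 1 ≤ n := by exact_mod_cast hn0
  set j := ⌊N⌋₊ with hjdef
  have hjN : (j : ℝ) ≤ N := Nat.floor_le (by linarith)
  have hNj : N < j + 1 := Nat.lt_floor_add_one N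
  have hj1 : 1 ≤ j := Nat.le_floor (by exact_mod_cast hN)
  have hj0 : (0 : ℝ) < j := by exact_mod_cast hj1
  have hjn : j ≤ n := by
    have : (j : ℝ) ≤ n := by linarith
    exact_mod_cast this
  have hf : (0 : ℝ) < j.factorial := by exact_mod_cast j.factorial_pos
  have hterm : (n.choose j : ℝ) ^ (b + 2) * (n - j).factorial ≤ (qseq (b + 2) n : ℝ) := by
    have : (n.choose (n - j) : ℚ) ^ (b + 2) * (n - j).factorial ≤ qseq (b + 2) n :=
      Finset.single_le_sum (f := fun k => (n.choose k : ℚ) ^ (b + 2) * (Nat.factorial k : ℚ))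
        (fun k _ => by positivity) (Finset.mem_range.mpr (by omega))
    rw [Nat.choose_symm hjn] at this
    exact_mod_cast this
  refine le_trans ?_ hterm
  rw [choose_pow_mul_factorial_eq hjn]
  refine mul_le_mul_of_nonneg_left ?_ (by positivity)
  have hsub : (0 : ℝ) < n - j := by linarith
  have hc : ((n : ℝ) - j) ^ j / j.factorial ≤ n.choose j := by
    rw [div_le_iff₀ hf]
    have h1 : (n - j) ^ j ≤ n.choose j * j.factorial := by
      rw [mul_comm, ← Nat.descFactorial_eq_factorial_mul_choose]
      exact (Nat.pow_le_pow_left (by omega) j).trans (Nat.pow_sub_le_descFactorial n j)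
    rw [← Nat.cast_sub hjn]
    exact_mod_cast h1
  have hc' : (((n : ℝ) - j) ^ j / j.factorial) ^ (b + 1) / j.factorial ≤
      (n.choose j : ℝ) ^ (b + 1) / j.factorial := by
    gcongr
  refine le_trans ?_ hc'
  rw [← Real.le_log_iff_exp_le (by positivity), Real.log_div (by positivity) hf.ne',
    Real.log_pow, Real.log_div (by positivity) hf.ne', Real.log_pow]
  push_cast
  have h1 := log_factorial_le hj1
  have h2 : Real.log n - 2 * j / n ≤ Real.log (n - j) := by
    have h := Real.one_sub_inv_le_log_of_pos (x := (n - j) / n) (by positivity)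
    rw [Real.log_div hsub.ne' hn0.ne', inv_div] at h
    have : -(2 * j / n) ≤ 1 - n / ((n : ℝ) - j) := by
      rw [one_sub_div hsub.ne', ← neg_div, div_le_div_iff₀ hn0 hsub]
      nlinarith
    linarith
  have h3 : Real.log j ≤ Real.log N := Real.log_le_log hj0 hjN
  have h4 : Real.log j ≤ Real.log n := Real.log_le_log hj0 (by linarith)
  have h5 : (j : ℝ) * (j / n) ≤ N ^ 2 / n := by
    rw [← mul_div_assoc]
    gcongr
    nlinarith
  have e1 : (b + 2) * Real.log j.factorial ≤
      (b + 2) * (j * Real.log N - j + Real.log n + 1) := by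
    gcongr
    have : j * Real.log j ≤ j * Real.log N := by gcongr
    linarith
  have e2 : (b + 1) * (j * (Real.log n - 2 * j / n)) ≤ (b + 1) * (j * Real.log (n - j)) := by
    gcongr
  have e3 : (b + 1) * (2 * (j * (j / n))) ≤ (b + 1) * (2 * (N ^ 2 / n)) := by gcongr
  have e4 : (b + 2) * N ≤ (b + 2) * (j + 1) := by gcongr
  have e5 : j * ((b + 2 : ℝ) * Real.log N) = j * ((b + 1) * Real.log n) := by rw [hNn]
  have e6 : 0 ≤ (b + 2) * Real.log n := mul_nonneg (by positivity) (Real.log_natCast_nonneg n)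
  have e7 : 0 ≤ N ^ 2 / n := by positivity
  have e8 : (b + 1) * (j * (Real.log n - 2 * j / n)) =
      j * ((b + 1) * Real.log n) - (b + 1) * (2 * (j * (j / n))) := by ring
  linarith

/-- The approximation bound with explicit error terms. -/
theorem abs_sub_pseq1_div_qseq_le {b n m : ℕ} {N κ η θ : ℝ} (hn : 1 ≤ n)
    (hN : 1 ≤ N) (hNn : (b + 2 : ℝ) * Real.log N = (b + 1) * Real.log n)
    (hm : 8 * N ≤ m) (hm' : (m : ℝ) ≤ 8 * N + 1) (hmn : (m : ℝ) + 1 / 2 ≤ n / 2)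
    (hκ : κ ≤ 1) (hη : η ≤ 1) (hκN : 1 ≤ κ * N) (hηN : 1 ≤ η * N) (hθ : -1 ≤ θ)
    (hright : ∀ y, 0 ≤ y → y ≤ η → phase (Real.pi - 2 * Real.pi / (b + 2)) κ y ≤ θ)
    (htop : ∀ x, x ≤ κ → phase (Real.pi - 2 * Real.pi / (b + 2)) x η ≤ θ) :
    |Real.eulerMascheroniConstant - (pseq1 (b + 2) n : ℝ) / (qseq (b + 2) n : ℝ)| ≤
      Real.exp ((b + 2) * (θ - 1) * N + (10 * b + 260) * (Real.log n + N ^ 2 / n + 1)) := by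
  have hn0 : (0 : ℝ) < n := by exact_mod_cast hn
  have hn1 : (1 : ℝ) ≤ n := by exact_mod_cast hn
  have hκN' : κ * N ≤ N := by nlinarith
  have hηN' : η * N ≤ N := by nlinarith
  have hmn' : m < n := by
    have : (m : ℝ) < n := by linarith
    exact_mod_cast this
  set R := Real.log n + N ^ 2 / n + 1 with hR
  have hlog : 0 ≤ Real.log n := Real.log_natCast_nonneg n
  have hNsq : 0 ≤ N ^ 2 / n := by positivity
  set C := n.factorial * Real.exp ((b + 2) * N * θ + (4 * b + 240) * R) with hC
  have hC0 : 0 < C := by positivity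
  have hhead : |∑ j ∈ Finset.range (m + 1), gammaTerm b n j| ≤ C * n := by
    have h1 := norm_rectIntegral_le (f := residueKernel b n) (x₀ := -(m : ℝ) - 1 / 2)
      (x₁ := κ * N) (h := η * N) (C := C) (by linarith) (by linarith) fun s hs =>
        norm_residueKernel_le_of_mem_rectBoundary hn hN hNn hm hm' hmn hκ hη hκN hηN hθ hright
          htop hs
    rw [rectIntegral_residueKernel hmn' (by linarith) (by linarith),
      Finset.sum_congr rfl fun j hj => deriv_interpolant (b := b) (n := n) (j := j)
        (by have := Finset.mem_range.mp hj; omega), ← Complex.ofReal_sum] at h1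
    simp only [norm_mul, Complex.norm_ofNat, Complex.norm_real, Complex.norm_I, mul_one,
      Real.norm_eq_abs, abs_of_pos Real.pi_pos] at h1
    have h2 : C * (2 * (κ * N - (-(m : ℝ) - 1 / 2)) + 4 * (η * N)) ≤ C * (2 * n) :=
      mul_le_mul_of_nonneg_left (by linarith) hC0.le
    nlinarith [Real.pi_gt_three, abs_nonneg (∑ j ∈ Finset.range (m + 1), gammaTerm b n j)]
  have htail : |∑ j ∈ Finset.Ico (m + 1) (n + 1), gammaTerm b n j| ≤
      n * (C * (3 * (b + 2) * n)) := by
    refine (Finset.abs_sum_le_sum_abs _ _).trans ?_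
    have h1 : ∀ j ∈ Finset.Ico (m + 1) (n + 1), |gammaTerm b n j| ≤ C * (3 * (b + 2) * n) := by
      intro j hj
      rw [Finset.mem_Ico] at hj
      have hmj : (m : ℝ) ≤ j := by exact_mod_cast (by omega : m ≤ j)
      refine (abs_gammaTerm_le hn (by omega) hN hNn (by linarith)).trans ?_
      refine mul_le_mul_of_nonneg_right (mul_le_mul_of_nonneg_left (Real.exp_le_exp.mpr ?_)
        (by positivity)) (by positivity)
      have h2 : (b + 2) * N * (-1) ≤ (b + 2) * N * θ :=
        mul_le_mul_of_nonneg_left hθ (by positivity)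
      have h3 : 0 ≤ (4 * b + 240) * R := by positivity
      linarith
    refine (Finset.sum_le_card_nsmul _ _ _ h1).trans ?_
    rw [nsmul_eq_mul, Nat.card_Ico]
    refine mul_le_mul_of_nonneg_right ?_ (by positivity)
    exact_mod_cast (by omega : n + 1 - (m + 1) ≤ n)
  have hsum : |(pseq1 (b + 2) n : ℝ) - Real.eulerMascheroniConstant * (qseq (b + 2) n : ℝ)| ≤
      C * Real.exp (4 * (b + 2) + 2 * Real.log n) := by
    rw [pseq1_sub_eq_sum_gammaTerm, ← Finset.sum_range_add_sum_Ico _ (by omega : m + 1 ≤ n + 1)]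
    refine (abs_add_le _ _).trans ((add_le_add hhead htail).trans ?_)
    have h1 : (4 * (b + 2) : ℝ) ≤ Real.exp (4 * (b + 2)) := by
      linarith [Real.add_one_le_exp (4 * (b + 2) : ℝ)]
    have h2 : Real.exp (2 * Real.log n) = (n : ℝ) ^ 2 := by
      rw [mul_comm, Real.exp_mul, Real.exp_log hn0]; norm_cast
    rw [Real.exp_add, h2]
    have h3 : (n : ℝ) + 3 * (b + 2) * n ^ 2 ≤ 4 * (b + 2) * n ^ 2 := by
      have h4 : (n : ℝ) ≤ n ^ 2 := by nlinarith
      have h5 : (0 : ℝ) ≤ b * n ^ 2 := by positivity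
      nlinarith
    calc C * n + n * (C * (3 * (b + 2) * n)) = C * (n + 3 * (b + 2) * n ^ 2) := by ring
      _ ≤ C * (Real.exp (4 * (b + 2)) * n ^ 2) := by
        refine mul_le_mul_of_nonneg_left (h3.trans ?_) hC0.le
        gcongr
  have hq := le_qseq hN (by linarith) hNn
  have hq0 : (0 : ℝ) < qseq (b + 2) n := lt_of_lt_of_le (by positivity) hq
  have heq : Real.eulerMascheroniConstant - (pseq1 (b + 2) n : ℝ) / (qseq (b + 2) n : ℝ) =
      -(((pseq1 (b + 2) n : ℝ) - Real.eulerMascheroniConstant * (qseq (b + 2) n : ℝ)) /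
        (qseq (b + 2) n : ℝ)) := by
    field_simp
    ring
  rw [heq, abs_neg, abs_div, abs_of_pos hq0, div_le_iff₀ hq0]
  refine hsum.trans (le_trans ?_ (mul_le_mul_of_nonneg_left hq (Real.exp_pos _).le))
  rw [hC, mul_assoc, ← Real.exp_add, mul_left_comm (Real.exp _), ← Real.exp_add]
  refine mul_le_mul_of_nonneg_left (Real.exp_le_exp.mpr ?_) (by positivity)
  have h1 : (1 : ℝ) ≤ R := by linarith
  have h2 : (0 : ℝ) ≤ b * (R - 1) := mul_nonneg (by positivity) (by linarith)
  have h3 : Real.log n ≤ R := by linarith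
  linarith

theorem stmt_0 (a : ℕ) (ha : 2 ≤ a) :
    ∀ ε : ℝ, 0 < ε → ∃ N : ℕ, ∀ n : ℕ, N ≤ n →
      |Real.eulerMascheroniConstant - (pseq1 a n : ℝ) / (qseq a n : ℝ)| ≤
        Real.exp (((a : ℝ) * (Real.cos (2 * Real.pi / (a : ℝ)) - 1) + ε) *
          (n : ℝ) ^ ((1 : ℝ) - 1 / (a : ℝ))) := by
  intro ε hε
  have ha0 : (0 : ℝ) < a := by positivity
  have ha1 : 1 / (a : ℝ) ≤ 1 / 2 := by
    have : (2 : ℝ) ≤ a := by exact_mod_cast ha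
    gcongr
  have hinv : 0 < 1 / (a : ℝ) := by positivity
  obtain ⟨κ, η, hκ0, hκ, hη0, hη, hright, htop⟩ :=
    exists_phase_contour ha (show 0 < ε / (2 * a) by positivity)
  obtain ⟨b, rfl⟩ := Nat.exists_eq_add_of_le' ha
  set α : ℝ := 1 - 1 / ((b + 2 : ℕ) : ℝ) with hα
  have hα0 : 0 < α := by linarith
  have hcast := tendsto_natCast_atTop_atTop (R := ℝ)
  have hpow : Filter.Tendsto (fun n : ℕ => (n : ℝ) ^ α) Filter.atTop Filter.atTop :=
    (tendsto_rpow_atTop hα0).comp hcast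
  set c : ℝ := ε / 2 / (10 * b + 260) / 3 with hc
  have hc0 : 0 < c := by positivity
  have hlog : ∀ᶠ n : ℕ in Filter.atTop, Real.log n ≤ c * (n : ℝ) ^ α := by
    filter_upwards [((isLittleO_log_rpow_atTop hα0).comp_tendsto hcast).bound hc0] with n h
    simp only [Function.comp, Real.norm_eq_abs] at h
    rw [abs_of_nonneg (by positivity : (0 : ℝ) ≤ (n : ℝ) ^ α)] at h
    exact (le_abs_self _).trans h
  have hsmall : Filter.Tendsto (fun n : ℕ => (n : ℝ) ^ (-(1 / ((b + 2 : ℕ) : ℝ)))) Filter.atTop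
      (nhds 0) := (tendsto_rpow_neg_atTop hinv).comp hcast
  have hmul : ∀ n : ℕ, 0 < n →
      (n : ℝ) ^ α = (n : ℝ) ^ (-(1 / ((b + 2 : ℕ) : ℝ))) * n := by
    intro n hn
    have hn0 : (0 : ℝ) < n := by exact_mod_cast hn
    nth_rewrite 3 [← Real.rpow_one (n : ℝ)]
    rw [← Real.rpow_add hn0]
    congr 1
    rw [hα]; ring
  have hev : ∀ᶠ n : ℕ in Filter.atTop,
      |Real.eulerMascheroniConstant - (pseq1 (b + 2) n : ℝ) / (qseq (b + 2) n : ℝ)| ≤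
        Real.exp ((((b + 2 : ℕ) : ℝ) * (Real.cos (2 * Real.pi / ((b + 2 : ℕ) : ℝ)) - 1) + ε) *
          (n : ℝ) ^ α) := by
    filter_upwards [hlog, Filter.eventually_ge_atTop 1, hpow.eventually_ge_atTop 1,
      hpow.eventually_ge_atTop (1 / κ), hpow.eventually_ge_atTop (1 / η),
      hpow.eventually_ge_atTop (1 / c), hsmall.eventually (ge_mem_nhds hc0),
      hsmall.eventually (ge_mem_nhds (show (0 : ℝ) < 1 / 20 by norm_num))]
      with n hlogn hn hN1 hNκ hNη hNc hsq h20
    have hn0 : (0 : ℝ) < n := by exact_mod_cast hn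
    have hNmul := hmul n hn
    set N := (n : ℝ) ^ α with hNdef
    have hN0 : 0 < N := by linarith
    have hNn : (b + 2 : ℝ) * Real.log N = (b + 1) * Real.log n := by
      rw [hNdef, Real.log_rpow hn0, hα]
      push_cast
      field_simp
      ring
    have hn20 : 20 * N ≤ n := by
      rw [hNmul]; nlinarith
    have hceil := Nat.le_ceil (8 * N)
    have hceil' := (Nat.ceil_lt_add_one (by positivity : 0 ≤ 8 * N)).le
    have hN2 : N ^ 2 / n ≤ c * N := by
      rw [div_le_iff₀ hn0, pow_two]
      nth_rewrite 2 [hNmul]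
      nlinarith [mul_le_mul_of_nonneg_left hsq (mul_pos hN0 hn0).le]
    have hone : 1 ≤ c * N := by rwa [div_le_iff₀' hc0] at hNc
    push_cast at hright htop ⊢
    have hcos := Real.neg_one_le_cos (2 * Real.pi / (b + 2 : ℝ))
    have hδ : 0 < ε / (2 * (b + 2 : ℝ)) := by positivity
    refine (abs_sub_pseq1_div_qseq_le hn hN1 hNn hceil hceil' (by linarith) hκ hη
      (by rwa [div_le_iff₀' hκ0] at hNκ) (by rwa [div_le_iff₀' hη0] at hNη)
      (by linarith) hright htop).trans (Real.exp_le_exp.mpr ?_)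
    have h1 : (10 * b + 260) * (Real.log n + N ^ 2 / n + 1) ≤ (10 * b + 260) * (3 * (c * N)) := by
      gcongr
      linarith
    have h2 : (10 * b + 260) * (3 * (c * N)) = ε / 2 * N := by
      rw [hc]; field_simp
    have h3 : (b + 2) * (Real.cos (2 * Real.pi / (b + 2)) + ε / (2 * (b + 2)) - 1) * N =
        (b + 2) * (Real.cos (2 * Real.pi / (b + 2)) - 1) * N + ε / 2 * N := by
      field_simp; ring
    linarith
  exact Filter.eventually_atTop.mp hev
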